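/- arXiv:1205.6671 — 4 statements merged into one kernel-verified Lean document; each statement's English description precedes it below -/
import Mathlib

section
/- A finite set H of homogeneous polynomials contained in an ideal I of P is a Pommaret basis of I with respect to the term order ≺ if and only if every nonzero polynomial f ∈ I possesses a unique involutive standard representation f = Σ_{h∈H} P_h·h, where each nonzero coefficient P_h lies in k[x_1,…,x_{cls(h)}] and satisfies lt(P_h·h) ≼ lt(f). -/
open MvPolynomial

/-- The (0-based) class of a nonzero exponent vector: the smallest index with
nonzero entry.  (The variables `x_1, …, x_n` of the paper are `X 0, …, X (n-1)`.) -/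
noncomputable def cls {n : ℕ} (μ : Fin n →₀ ℕ) : ℕ :=
  sInf {i : ℕ | ∃ hi : i < n, μ ⟨i, hi⟩ ≠ 0}

/-- `x^μ` involutively divides `x^ν` : it divides it and the quotient only involves
the multiplicative variables `x_1, …, x_{cls μ}` of `x^μ`. -/
def InvDiv {n : ℕ} (μ ν : Fin n →₀ ℕ) : Prop :=
  μ ≤ ν ∧ ∀ j : Fin n, ν j ≠ μ j → (j : ℕ) ≤ cls μ

/-- The exponent of the leading term of `f` with respect to the monomial order `m`. -/
noncomputable def ldeg {n : ℕ} {K : Type*} [Field K] (m : MonomialOrder (Fin n))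
    (f : MvPolynomial (Fin n) K) : Fin n →₀ ℕ :=
  m.toSyn.symm (f.support.sup fun μ => m.toSyn μ)

/-- The leading ideal `lt(I)` of an ideal `I` with respect to `m`. -/
noncomputable def ltIdeal {n : ℕ} {K : Type*} [Field K] (m : MonomialOrder (Fin n))
    (I : Ideal (MvPolynomial (Fin n) K)) : Ideal (MvPolynomial (Fin n) K) :=
  Ideal.span {g | ∃ f ∈ I, f ≠ 0 ∧ g = monomial (ldeg m f) (1 : K)}

/-- `H` is a (finite, monomial) Pommaret basis of the monomial ideal `I`:
it generates `I` and every monomial of `I` has a unique involutive divisor in `H`. -/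
def IsMonPB {n : ℕ} {K : Type*} [Field K] (H : Set (Fin n →₀ ℕ))
    (I : Ideal (MvPolynomial (Fin n) K)) : Prop :=
  H.Finite ∧ I = Ideal.span ((fun μ => monomial μ (1 : K)) '' H) ∧
    ∀ ν : Fin n →₀ ℕ, monomial ν (1 : K) ∈ I → ∃! μ, μ ∈ H ∧ InvDiv μ ν

/-- `H` is a Pommaret basis of the polynomial ideal `I` w.r.t. the monomial order `m`:
its elements lie in `I`, are nonzero with pairwise distinct leading terms, and the
leading terms form a Pommaret basis of the leading ideal. -/
def IsPB {n : ℕ} {K : Type*} [Field K] (m : MonomialOrder (Fin n))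
    (H : Finset (MvPolynomial (Fin n) K)) (I : Ideal (MvPolynomial (Fin n) K)) : Prop :=
  (∀ h ∈ H, h ∈ I) ∧ (∀ h ∈ H, h ≠ 0) ∧
    Set.InjOn (fun h : MvPolynomial (Fin n) K => ldeg m h) ↑H ∧
    IsMonPB ((fun h : MvPolynomial (Fin n) K => ldeg m h) '' ↑H) (ltIdeal m I)

/-- `m` is the degree reverse lexicographic order (with the reversed conventions of the
paper: for equal degrees, `μ ≺ ν` iff the first nonvanishing entry of `μ - ν` is positive). -/
def IsRevLex {n : ℕ} (m : MonomialOrder (Fin n)) : Prop :=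
  ∀ μ ν : Fin n →₀ ℕ, m.toSyn μ < m.toSyn ν ↔
    ((μ.sum fun _ e => e) < (ν.sum fun _ e => e) ∨
      ((μ.sum fun _ e => e) = (ν.sum fun _ e => e) ∧
        ∃ i : Fin n, ν i < μ i ∧ ∀ j : Fin n, j < i → μ j = ν j))

/-- `I` is a homogeneous ideal. -/
def IsHomIdeal {n : ℕ} {K : Type*} [Field K] (I : Ideal (MvPolynomial (Fin n) K)) : Prop :=
  ∃ S : Set (MvPolynomial (Fin n) K), (∀ f ∈ S, ∃ d, f.IsHomogeneous d) ∧ I = Ideal.span S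

lemma aux_ldeg {n : ℕ} {K : Type*} [Field K] (m : MonomialOrder (Fin n))
    (f : MvPolynomial (Fin n) K) : ldeg m f = m.degree f := rfl

/-- A product with a multiplicative coefficient has an involutively divisible leading term. -/
lemma aux_invDiv {n : ℕ} {K : Type*} [Field K] (m : MonomialOrder (Fin n))
    (Q h : MvPolynomial (Fin n) K) (hQ : Q ≠ 0) (hh : h ≠ 0)
    (hs : Q ∈ MvPolynomial.supported K {j : Fin n | (j : ℕ) ≤ cls (ldeg m h)}) :
    InvDiv (ldeg m h) (ldeg m (Q * h)) := by
  rw [aux_ldeg] at *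
  rw [aux_ldeg, MonomialOrder.degree_mul hQ hh]
  refine ⟨le_add_self, fun j hj => ?_⟩
  have h1 : m.degree Q j ≠ 0 := by
    intro h0
    apply hj
    simp [h0]
  rw [MvPolynomial.mem_supported] at hs
  apply hs
  rw [Finset.mem_coe, MvPolynomial.mem_vars_iff_mem_support]
  exact ⟨m.degree Q, m.degree_mem_support hQ, Finsupp.mem_support_iff.2 h1⟩

lemma aux_mon_supported {n : ℕ} {K : Type*} [Field K] (μ ν : Fin n →₀ ℕ) (h : InvDiv μ ν) (c : K) :
    monomial (ν - μ) c ∈ MvPolynomial.supported K {j : Fin n | (j : ℕ) ≤ cls μ} := by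
  rw [MvPolynomial.mem_supported]
  intro j hj
  rw [Finset.mem_coe, MvPolynomial.mem_vars_iff_mem_support] at hj
  obtain ⟨d, hd, hjd⟩ := hj
  have : d = ν - μ := by
    have := MvPolynomial.support_monomial_subset hd
    simpa using this
  subst this
  apply h.2 j
  intro he
  rw [Finsupp.mem_support_iff] at hjd
  apply hjd
  simp [he]

lemma aux_degree_mon_mul {n : ℕ} {K : Type*} [Field K] (m : MonomialOrder (Fin n))
    (μ : Fin n →₀ ℕ) (c : K) (hc : c ≠ 0) (h : MvPolynomial (Fin n) K) (hh : h ≠ 0) :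
    m.degree (monomial μ c * h) = μ + m.degree h := by
  classical
  rw [MonomialOrder.degree_mul (by simpa using hc) hh, MonomialOrder.degree_monomial, if_neg hc]

/-- Cancelling the leading terms. -/
lemma aux_cancel {n : ℕ} {K : Type*} [Field K] (m : MonomialOrder (Fin n))
    (f h : MvPolynomial (Fin n) K) (hf : f ≠ 0) (hh : h ≠ 0) (hle : m.degree h ≤ m.degree f) :
    ∃ c : K, c ≠ 0 ∧ (f - monomial (m.degree f - m.degree h) c * h = 0 ∨
      m.toSyn (m.degree (f - monomial (m.degree f - m.degree h) c * h)) <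
        m.toSyn (m.degree f)) := by
  have hlf : m.leadingCoeff f ≠ 0 := m.leadingCoeff_ne_zero_iff.2 hf
  have hlh : m.leadingCoeff h ≠ 0 := m.leadingCoeff_ne_zero_iff.2 hh
  refine ⟨m.leadingCoeff f / m.leadingCoeff h, div_ne_zero hlf hlh, ?_⟩
  set c := m.leadingCoeff f / m.leadingCoeff h with hc
  have hc0 : c ≠ 0 := div_ne_zero hlf hlh
  have hd := aux_degree_mon_mul m (m.degree f - m.degree h) c hc0 h hh
  rw [tsub_add_cancel_of_le hle] at hd
  rw [or_iff_not_imp_left]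
  intro hg
  refine lt_of_le_of_ne ?_ ?_
  · refine (m.degree_sub_le).trans ?_
    rw [hd, max_self]
  · intro he
    have he := m.toSyn.injective he
    have h1 := m.leadingCoeff_ne_zero_iff.2 hg
    apply h1
    rw [MonomialOrder.leadingCoeff, he, coeff_sub]
    have : coeff (m.degree f) (monomial (m.degree f - m.degree h) c * h)
        = c * m.leadingCoeff h := by
      conv_lhs => rw [← tsub_add_cancel_of_le hle]
      rw [tsub_add_cancel_of_le hle]
      conv_lhs => rw [← tsub_add_cancel_of_le hle, add_tsub_cancel_right]
      rw [coeff_monomial_mul]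
      rfl
    rw [this, hc, div_mul_cancel₀ _ hlh]
    simp [MonomialOrder.leadingCoeff]

/-- Monomials in the leading ideal are leading monomials. -/
lemma aux_lt {n : ℕ} {K : Type*} [Field K] (m : MonomialOrder (Fin n))
    (I : Ideal (MvPolynomial (Fin n) K)) (ν : Fin n →₀ ℕ)
    (h : monomial ν (1 : K) ∈ ltIdeal m I) : ∃ f ∈ I, f ≠ 0 ∧ m.degree f = ν := by
  classical
  have hset : {g | ∃ f ∈ I, f ≠ 0 ∧ g = monomial (ldeg m f) (1 : K)} =
      (fun s => monomial s (1 : K)) '' {s | ∃ f ∈ I, f ≠ 0 ∧ ldeg m f = s} := by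
    ext g
    constructor
    · rintro ⟨f, hf, h0, rfl⟩
      exact ⟨_, ⟨f, hf, h0, rfl⟩, rfl⟩
    · rintro ⟨_, ⟨f, hf, h0, rfl⟩, rfl⟩
      exact ⟨f, hf, h0, rfl⟩
  rw [ltIdeal, hset, MvPolynomial.mem_ideal_span_monomial_image] at h
  obtain ⟨s, ⟨f, hf, h0, rfl⟩, hs⟩ := h ν (by simp [MvPolynomial.support_monomial])
  refine ⟨monomial (ν - m.degree f) 1 * f, I.mul_mem_left _ hf, ?_, ?_⟩
  · exact mul_ne_zero (by simp) h0
  · rw [aux_degree_mon_mul m _ _ one_ne_zero _ h0]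
    exact tsub_add_cancel_of_le hs

/-- In a standard representation some summand attains the leading term. -/
lemma aux_top {n : ℕ} {K : Type*} [Field K] (m : MonomialOrder (Fin n))
    (H : Finset (MvPolynomial (Fin n) K)) (P : MvPolynomial (Fin n) K → MvPolynomial (Fin n) K)
    (f : MvPolynomial (Fin n) K) (hf : f ≠ 0) (hs : f = ∑ h ∈ H, P h * h)
    (hle : ∀ h ∈ H, P h ≠ 0 → m.toSyn (m.degree (P h * h)) ≤ m.toSyn (m.degree f)) :
    ∃ h ∈ H, P h ≠ 0 ∧ h ≠ 0 ∧ m.degree (P h * h) = m.degree f := by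
  have h1 : coeff (m.degree f) f ≠ 0 := m.leadingCoeff_ne_zero_iff.2 hf
  have h2 : coeff (m.degree f) f = ∑ h ∈ H, coeff (m.degree f) (P h * h) := by
    rw [← coeff_sum, ← hs]
  rw [h2] at h1
  obtain ⟨h, hh, hc⟩ := Finset.exists_ne_zero_of_sum_ne_zero h1
  have hP : P h ≠ 0 := by rintro h0; simp [h0] at hc
  have hn : h ≠ 0 := by rintro rfl; simp at hc
  refine ⟨h, hh, hP, hn, m.toSyn.injective (le_antisymm (hle h hh hP) ?_)⟩
  exact m.le_degree (mem_support_iff.2 hc)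

lemma aux_unique {n : ℕ} {K : Type*} [Field K] (m : MonomialOrder (Fin n))
    (H : Finset (MvPolynomial (Fin n) K)) (hH0 : ∀ h ∈ H, h ≠ 0)
    (hu : ∀ ν, ∀ h₁ ∈ H, ∀ h₂ ∈ H, InvDiv (ldeg m h₁) ν → InvDiv (ldeg m h₂) ν → h₁ = h₂)
    (Q : MvPolynomial (Fin n) K → MvPolynomial (Fin n) K)
    (hs : ∑ h ∈ H, Q h * h = 0)
    (hQ : ∀ h ∈ H, Q h ∈ MvPolynomial.supported K {j : Fin n | (j : ℕ) ≤ cls (ldeg m h)}) :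
    ∀ h ∈ H, Q h = 0 := by
  classical
  by_contra! hcon
  obtain ⟨h₀, hh₀, hq₀⟩ := hcon
  obtain ⟨h, hh, hmax⟩ := (H.filter (fun h => Q h ≠ 0)).exists_max_image
    (fun h => m.toSyn (m.degree (Q h * h))) ⟨h₀, by simp [hh₀, hq₀]⟩
  rw [Finset.mem_filter] at hh
  have hne : Q h * h ≠ 0 := mul_ne_zero hh.2 (hH0 h hh.1)
  have h1 : coeff (m.degree (Q h * h)) (∑ h ∈ H, Q h * h) =
      coeff (m.degree (Q h * h)) (Q h * h) := by
    rw [coeff_sum]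
    apply Finset.sum_eq_single_of_mem h hh.1
    intro g hg hgh
    by_contra hc
    have hP : Q g ≠ 0 := by rintro h0; simp [h0] at hc
    have e : m.degree (Q g * g) = m.degree (Q h * h) :=
      m.toSyn.injective (le_antisymm (hmax g (by simp [hg, hP])) 
        (m.le_degree (mem_support_iff.2 hc)))
    apply hgh
    refine hu (m.degree (Q h * h)) g hg h hh.1 ?_ ?_
    · rw [← e]; exact aux_invDiv m _ _ hP (hH0 g hg) (hQ g hg)
    · exact aux_invDiv m _ _ hh.2 (hH0 h hh.1) (hQ h hh.1)
  rw [hs, coeff_zero] at h1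
  exact m.leadingCoeff_ne_zero_iff.2 hne h1.symm

/-- The standard representation predicate with bound `d`. -/
def AuxRep {n : ℕ} {K : Type*} [Field K] (m : MonomialOrder (Fin n))
    (H : Finset (MvPolynomial (Fin n) K)) (f : MvPolynomial (Fin n) K) (d : Fin n →₀ ℕ)
    (P : MvPolynomial (Fin n) K → MvPolynomial (Fin n) K) : Prop :=
  (∀ g, g ∉ H → P g = 0) ∧ f = ∑ h ∈ H, P h * h ∧
          ∀ h ∈ H, P h ≠ 0 →
            P h ∈ MvPolynomial.supported K {j : Fin n | (j : ℕ) ≤ cls (ldeg m h)} ∧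
            m.toSyn (ldeg m (P h * h)) ≤ m.toSyn d

lemma AuxRep.add {n : ℕ} {K : Type*} [Field K] {m : MonomialOrder (Fin n)}
    {H : Finset (MvPolynomial (Fin n) K)} {f g : MvPolynomial (Fin n) K} {d : Fin n →₀ ℕ}
    {P Q : MvPolynomial (Fin n) K → MvPolynomial (Fin n) K}
    (hP : AuxRep m H f d P) (hQ : AuxRep m H g d Q) : AuxRep m H (f + g) d (P + Q) := by
  refine ⟨fun x hx => by simp [hP.1 x hx, hQ.1 x hx], ?_, ?_⟩
  · rw [hP.2.1, hQ.2.1, ← Finset.sum_add_distrib]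
    simp [add_mul]
  · intro h hh hne
    by_cases h1 : P h = 0
    · by_cases h2 : Q h = 0
      · simp [h1, h2] at hne
      · simpa [h1] using hQ.2.2 h hh h2
    · by_cases h2 : Q h = 0
      · simpa [h2] using hP.2.2 h hh h1
      · obtain ⟨a, b⟩ := hP.2.2 h hh h1
        obtain ⟨a', b'⟩ := hQ.2.2 h hh h2
        refine ⟨add_mem a a', ?_⟩
        rw [Pi.add_apply, add_mul]
        exact (m.degree_add_le).trans (max_le b b')

lemma AuxRep.mono {n : ℕ} {K : Type*} [Field K] {m : MonomialOrder (Fin n)}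
    {H : Finset (MvPolynomial (Fin n) K)} {f : MvPolynomial (Fin n) K} {d e : Fin n →₀ ℕ}
    {P : MvPolynomial (Fin n) K → MvPolynomial (Fin n) K}
    (hP : AuxRep m H f d P) (hde : m.toSyn d ≤ m.toSyn e) : AuxRep m H f e P :=
  ⟨hP.1, hP.2.1, fun h hh hne => ⟨(hP.2.2 h hh hne).1, (hP.2.2 h hh hne).2.trans hde⟩⟩

lemma auxRep_zero {n : ℕ} {K : Type*} [Field K] (m : MonomialOrder (Fin n))
    (H : Finset (MvPolynomial (Fin n) K)) (d : Fin n →₀ ℕ) : AuxRep m H 0 d 0 :=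
  ⟨fun _ _ => rfl, by simp, fun h _ hne => absurd rfl hne⟩

open Classical in
lemma auxRep_single {n : ℕ} {K : Type*} [Field K] (m : MonomialOrder (Fin n))
    (H : Finset (MvPolynomial (Fin n) K)) (ν : Fin n →₀ ℕ) (h : MvPolynomial (Fin n) K)
    (hh : h ∈ H) (hd : InvDiv (ldeg m h) ν) (h0 : h ≠ 0) (c : K) :
    AuxRep m H (monomial (ν - m.degree h) c * h) ν
      (Pi.single h (monomial (ν - m.degree h) c)) := by
  refine ⟨?_, ?_, ?_⟩
  · intro g hg
    rw [Pi.single_eq_of_ne]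
    rintro rfl
    exact hg hh
  · rw [Finset.sum_eq_single_of_mem h hh, Pi.single_eq_same]
    intro g _ hg
    rw [Pi.single_eq_of_ne hg, zero_mul]
  · intro g hg hne
    by_cases hgh : g = h
    · subst hgh
      rw [Pi.single_eq_same] at hne ⊢
      refine ⟨aux_mon_supported _ _ hd c, ?_⟩
      rw [aux_ldeg, aux_degree_mon_mul m _ _ (by rintro rfl; simp at hne) _ h0]
      rw [tsub_add_cancel_of_le (show m.degree g ≤ ν from hd.1)]
    · rw [Pi.single_eq_of_ne hgh] at hne
      exact absurd rfl hne

lemma auxRep_exists {n : ℕ} {K : Type*} [Field K] (m : MonomialOrder (Fin n))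
    (I : Ideal (MvPolynomial (Fin n) K)) (H : Finset (MvPolynomial (Fin n) K))
    (hHI : ∀ h ∈ H, h ∈ I) (hH0 : ∀ h ∈ H, h ≠ 0)
    (he : ∀ f ∈ I, f ≠ 0 → ∃ h ∈ H, InvDiv (ldeg m h) (m.degree f)) :
    ∀ (a : m.syn) (f : MvPolynomial (Fin n) K), f ∈ I → f ≠ 0 → m.toSyn (m.degree f) = a →
      ∃ P, AuxRep m H f (m.degree f) P := by
  classical
  intro a
  induction a using WellFoundedLT.induction with
  | ind a ih =>
    rintro f hf hf0 rfl
    obtain ⟨h, hh, hd⟩ := he f hf hf0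
    obtain ⟨c, hc, hg⟩ := aux_cancel m f h hf0 (hH0 h hh) hd.1
    have hs := auxRep_single m H (m.degree f) h hh hd (hH0 h hh) c
    set q := monomial (m.degree f - m.degree h) c * h with hq
    by_cases hz : f - q = 0
    · rw [sub_eq_zero] at hz
      rw [← hz] at hs
      exact ⟨_, hs⟩
    · have hlt := hg.resolve_left hz
      obtain ⟨P, hP⟩ := ih _ hlt (f - q) (I.sub_mem hf (I.mul_mem_left _ (hHI h hh))) hz rfl
      have := (hP.mono hlt.le).add hs
      rw [sub_add_cancel] at this
      exact ⟨_, this⟩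

/-- Prop. 2.2: a finite set `H` of homogeneous polynomials contained in the
ideal `I` is a Pommaret basis of `I` w.r.t. `m` iff every nonzero `f ∈ I` has a unique
involutive standard representation `f = ∑_{h ∈ H} P_h · h`. -/
theorem statement0 {n : ℕ} {K : Type*} [Field K] (m : MonomialOrder (Fin n))
    (I : Ideal (MvPolynomial (Fin n) K)) (hI0 : I ≠ ⊥) (hIT : I ≠ ⊤) (hIhom : IsHomIdeal I)
    (H : Finset (MvPolynomial (Fin n) K))
    (hHhom : ∀ h ∈ H, ∃ d, h.IsHomogeneous d) (hHI : ∀ h ∈ H, h ∈ I) :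
    IsPB m H I ↔
      ∀ f ∈ I, f ≠ 0 →
        ∃! P : MvPolynomial (Fin n) K → MvPolynomial (Fin n) K,
          (∀ g, g ∉ H → P g = 0) ∧ f = ∑ h ∈ H, P h * h ∧
          ∀ h ∈ H, P h ≠ 0 →
            P h ∈ MvPolynomial.supported K {j : Fin n | (j : ℕ) ≤ cls (ldeg m h)} ∧
            m.toSyn (ldeg m (P h * h)) ≤ m.toSyn (ldeg m f) := by
  classical
  constructor
  · rintro ⟨-, hH0, hinj, -, -, hpb⟩ f hf hf0
    have hmem : ∀ f ∈ I, f ≠ 0 → monomial (m.degree f) (1 : K) ∈ ltIdeal m I :=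
      fun f hf hf0 => Ideal.subset_span ⟨f, hf, hf0, rfl⟩
    have he : ∀ f ∈ I, f ≠ 0 → ∃ h ∈ H, InvDiv (ldeg m h) (m.degree f) := by
      intro f hf hf0
      obtain ⟨_, ⟨⟨h, hh, rfl⟩, hd⟩, -⟩ := hpb _ (hmem f hf hf0)
      exact ⟨h, hh, hd⟩
    have hu : ∀ ν, ∀ h₁ ∈ H, ∀ h₂ ∈ H, InvDiv (ldeg m h₁) ν → InvDiv (ldeg m h₂) ν →
        h₁ = h₂ := by
      intro ν h₁ hh₁ h₂ hh₂ d₁ d₂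
      have hν : monomial ν (1 : K) ∈ ltIdeal m I := by
        have h1 := Ideal.mul_mem_left (ltIdeal m I) (monomial (ν - m.degree h₁) (1 : K))
          (hmem h₁ (hHI h₁ hh₁) (hH0 h₁ hh₁))
        rwa [monomial_mul, one_mul, tsub_add_cancel_of_le (show m.degree h₁ ≤ ν from d₁.1)] at h1
      exact hinj hh₁ hh₂ ((hpb ν hν).unique ⟨⟨h₁, hh₁, rfl⟩, d₁⟩ ⟨⟨h₂, hh₂, rfl⟩, d₂⟩)
    obtain ⟨P, hP⟩ := auxRep_exists m I H hHI hH0 he _ f hf hf0 rfl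
    refine ⟨P, hP, ?_⟩
    intro P' hP'
    have hsup : ∀ P, AuxRep m H f (m.degree f) P → ∀ h ∈ H,
        P h ∈ MvPolynomial.supported K {j : Fin n | (j : ℕ) ≤ cls (ldeg m h)} := by
      intro P hP h hh
      by_cases h0 : P h = 0
      · rw [h0]; exact zero_mem _
      · exact (hP.2.2 h hh h0).1
    have hz := aux_unique m H hH0 hu (fun h => P' h - P h)
      (by simp only [sub_mul, Finset.sum_sub_distrib]
          rw [← hP.2.1, ← hP'.2.1, sub_self])
      (fun h hh => sub_mem (hsup P' hP' h hh) (hsup P hP h hh))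
    funext g
    by_cases hg : g ∈ H
    · exact sub_eq_zero.1 (hz g hg)
    · rw [hP.1 g hg, hP'.1 g hg]
  · intro hR
    have hR' : ∀ f ∈ I, f ≠ 0 → ∃! P, AuxRep m H f (m.degree f) P := hR
    have hH0 : ∀ h ∈ H, h ≠ 0 := by
      rintro _ hh rfl
      obtain ⟨f, hf, hf0⟩ := Submodule.exists_mem_ne_zero_of_ne_bot hI0
      obtain ⟨P, hP, hu⟩ := hR' f hf hf0
      have h2 : AuxRep m H f (m.degree f) (P + Pi.single 0 1) := by
        have : AuxRep m H 0 (m.degree f) (Pi.single 0 1) := by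
          refine ⟨?_, ?_, ?_⟩
          · intro g hg
            rw [Pi.single_eq_of_ne]
            rintro rfl
            exact hg hh
          · symm
            apply Finset.sum_eq_zero
            intro g _
            by_cases hg : g = 0
            · simp [hg]
            · rw [Pi.single_eq_of_ne hg, zero_mul]
          · intro g hg hne
            by_cases hg : g = 0
            · subst hg
              rw [Pi.single_eq_same]
              refine ⟨one_mem _, ?_⟩
              rw [aux_ldeg, mul_zero, m.degree_zero, map_zero]
              exact m.zero_le _
            · rw [Pi.single_eq_of_ne hg] at hne
              exact absurd rfl hne
        simpa using hP.add this
      have := congrFun (hu _ h2) 0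
      simp at this
    have he : ∀ f ∈ I, f ≠ 0 → ∃ h ∈ H, InvDiv (ldeg m h) (m.degree f) := by
      intro f hf hf0
      obtain ⟨P, hP, -⟩ := hR' f hf hf0
      obtain ⟨h, hh, hPh, h0, hd⟩ := aux_top m H P f hf0 hP.2.1
        (fun h hh hne => (hP.2.2 h hh hne).2)
      refine ⟨h, hh, ?_⟩
      rw [← hd]
      exact aux_invDiv m _ _ hPh h0 (hP.2.2 h hh hPh).1
    have hu : ∀ ν, ∀ h₁ ∈ H, ∀ h₂ ∈ H, InvDiv (ldeg m h₁) ν → InvDiv (ldeg m h₂) ν →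
        h₁ = h₂ := by
      intro ν h₁ hh₁ h₂ hh₂ d₁ d₂
      by_contra hne
      have r₁ := auxRep_single m H ν h₁ hh₁ d₁ (hH0 h₁ hh₁) 1
      have hfd : m.degree (monomial (ν - m.degree h₁) (1 : K) * h₁) = ν := by
        rw [aux_degree_mon_mul m _ _ one_ne_zero _ (hH0 h₁ hh₁)]
        exact tsub_add_cancel_of_le d₁.1
      have hf0 : monomial (ν - m.degree h₁) (1 : K) * h₁ ≠ 0 :=
        mul_ne_zero (by simp) (hH0 h₁ hh₁)
      have hfI : monomial (ν - m.degree h₁) (1 : K) * h₁ ∈ I := I.mul_mem_left _ (hHI h₁ hh₁)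
      set f := monomial (ν - m.degree h₁) (1 : K) * h₁ with hfdef
      obtain ⟨c, hc, hg⟩ := aux_cancel m f h₂ hf0 (hH0 h₂ hh₂) (by rw [hfd]; exact d₂.1)
      rw [hfd] at hg
      have r₂ := auxRep_single m H ν h₂ hh₂ d₂ (hH0 h₂ hh₂) c
      have hqI : monomial (ν - m.degree h₂) c * h₂ ∈ I := I.mul_mem_left _ (hHI h₂ hh₂)
      set q := monomial (ν - m.degree h₂) c * h₂ with hq
      obtain ⟨P, hP, hP1⟩ : ∃ P, AuxRep m H (f - q) ν P ∧
          P h₁ ≠ monomial (ν - m.degree h₁) (1 : K) := by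
        by_cases hz : f - q = 0
        · rw [hz]
          refine ⟨0, auxRep_zero m H ν, ?_⟩
          intro h0
          simp only [Pi.zero_apply] at h0
          exact hf0 (by rw [hfdef, ← h0, zero_mul])
        · have hlt := hg.resolve_left hz
          obtain ⟨P, hP, -⟩ := hR' (f - q) (I.sub_mem hfI hqI) hz
          refine ⟨P, hP.mono hlt.le, ?_⟩
          intro h0
          have h1 := (hP.2.2 h₁ hh₁ (by rw [h0]; simp)).2
          rw [h0, ← hfdef, aux_ldeg, hfd] at h1
          exact absurd h1 (not_le.2 hlt)
      have r₃ := hP.add r₂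
      rw [sub_add_cancel] at r₃
      have hex := hR' f hfI hf0
      rw [hfd] at hex
      have h3 := congrFun (hex.unique r₁ r₃) h₁
      rw [Pi.add_apply, Pi.single_eq_same, Pi.single_eq_of_ne hne, add_zero] at h3
      exact hP1 h3.symm
    refine ⟨hHI, hH0, ?_, H.finite_toSet.image _, ?_, ?_⟩
    · intro h₁ hh₁ h₂ hh₂ hd
      refine hu (ldeg m h₁) h₁ hh₁ h₂ hh₂ ⟨le_rfl, fun j hj => absurd rfl hj⟩ ?_
      have hd' : ldeg m h₁ = ldeg m h₂ := hd
      rw [hd']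
      exact ⟨le_rfl, fun j hj => absurd rfl hj⟩
    · apply le_antisymm
      · rw [ltIdeal, Ideal.span_le]
        rintro _ ⟨f, hf, hf0, rfl⟩
        obtain ⟨h, hh, hd⟩ := he f hf hf0
        have h1 : monomial (ldeg m h) (1 : K) ∈ Ideal.span ((fun μ => monomial μ (1 : K)) ''
            ((fun h : MvPolynomial (Fin n) K => ldeg m h) '' ↑H)) :=
          Ideal.subset_span ⟨_, ⟨h, hh, rfl⟩, rfl⟩
        have h2 := Ideal.mul_mem_left _ (monomial (m.degree f - ldeg m h) (1 : K)) h1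
        rwa [monomial_mul, one_mul, tsub_add_cancel_of_le hd.1] at h2
      · rw [Ideal.span_le]
        rintro _ ⟨_, ⟨h, hh, rfl⟩, rfl⟩
        exact Ideal.subset_span ⟨h, hHI h hh, hH0 h hh, rfl⟩
    · intro ν hν
      obtain ⟨f, hf, hf0, rfl⟩ := aux_lt m I ν hν
      obtain ⟨h, hh, hd⟩ := he f hf hf0
      refine ⟨ldeg m h, ⟨⟨h, hh, rfl⟩, hd⟩, ?_⟩
      rintro _ ⟨⟨h', hh', rfl⟩, hd'⟩
      rw [hu _ h' hh' h hh hd' hd]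
end

section
/- Let H be a finite set of polynomials and ≺ a term order such that no leading term in lt(H) involutively divides another one. Then H is a Pommaret basis of the ideal ⟨H⟩ with respect to ≺ if and only if for every h ∈ H and every non-multiplicative index cls(h) < j ≤ n the product x_j·h possesses an involutive standard representation with respect to H. -/
open MvPolynomial

/-- strict "larger from the top" relation -/
def RevBig {n : ℕ} (a b : Fin n →₀ ℕ) : Prop :=
  ∃ i, b i < a i ∧ ∀ k, i < k → a k = b k

theorem RevBig.trans {n : ℕ} {a b c : Fin n →₀ ℕ} (h1 : RevBig a b) (h2 : RevBig b c) :
    RevBig a c := by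
  obtain ⟨i, hi, hi'⟩ := h1
  obtain ⟨j, hj, hj'⟩ := h2
  rcases lt_trichotomy i j with h | h | h
  · exact ⟨j, by rw [hi' j h]; exact hj, fun k hk => (hi' k (h.trans hk)).trans (hj' k hk)⟩
  · subst h
    exact ⟨i, hj.trans hi, fun k hk => (hi' k hk).trans (hj' k hk)⟩
  · exact ⟨i, by rw [← hj' i h]; exact hi, fun k hk => (hi' k hk).trans (hj' k (h.trans hk))⟩

theorem RevBig.irrefl {n : ℕ} {a : Fin n →₀ ℕ} : ¬ RevBig a a := by
  rintro ⟨i, hi, _⟩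
  exact lt_irrefl _ hi

theorem eq_zero_of_lt_cls {n : ℕ} {μ : Fin n →₀ ℕ} {j : Fin n} (h : (j : ℕ) < cls μ) :
    μ j = 0 := by
  by_contra hne
  exact Nat.notMem_of_lt_sInf h ⟨j.2, hne⟩

theorem invDiv_refl {n : ℕ} (μ : Fin n →₀ ℕ) : InvDiv μ μ :=
  ⟨le_rfl, fun _ h => absurd rfl h⟩

theorem invDiv_add {n : ℕ} {μ σ : Fin n →₀ ℕ} (h : ∀ j : Fin n, σ j ≠ 0 → (j : ℕ) ≤ cls μ) :
    InvDiv μ (σ + μ) :=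
  ⟨le_add_self, fun j hj => h j fun h0 => hj (by simp [h0])⟩

/-- two involutive divisors of the same monomial are comparable -/
theorem invDiv_comparable_aux {n : ℕ} {μ ν ρ : Fin n →₀ ℕ} (h1 : InvDiv μ ρ) (h2 : InvDiv ν ρ)
    (hle : cls μ ≤ cls ν) : InvDiv μ ν ∨ InvDiv ν μ := by
  have e1 : ∀ j : Fin n, cls μ < (j : ℕ) → ρ j = μ j := fun j hj => by
    by_contra h; exact absurd (h1.2 j h) (by omega)
  have e2 : ∀ j : Fin n, cls ν < (j : ℕ) → ρ j = ν j := fun j hj => by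
    by_contra h; exact absurd (h2.2 j h) (by omega)
  rcases hle.lt_or_eq with hlt | heq
  · right
    refine ⟨fun j => ?_, fun j hj => ?_⟩
    · rcases lt_or_ge (j : ℕ) (cls ν) with h | h
      · rw [eq_zero_of_lt_cls h]; exact Nat.zero_le _
      · rw [← e1 j (by omega)]; exact h2.1 j
    · by_contra h
      exact hj ((e1 j (by omega)).symm.trans (e2 j (by omega)))
  · have key : ∀ j : Fin n, (j : ℕ) ≠ cls ν → μ j = ν j := fun j hj => by
      rcases lt_or_gt_of_ne hj with h | h
      · rw [eq_zero_of_lt_cls h, eq_zero_of_lt_cls (heq ▸ h)]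
      · exact (e1 j (by omega)).symm.trans (e2 j (by omega))
    by_cases hc : cls ν < n
    · rcases le_total (μ ⟨cls ν, hc⟩) (ν ⟨cls ν, hc⟩) with h | h
      · left
        refine ⟨fun j => ?_, fun j hj => ?_⟩
        · by_cases hj : (j : ℕ) = cls ν
          · have : j = ⟨cls ν, hc⟩ := Fin.ext hj
            rw [this]; exact h
          · exact (key j hj).le
        · by_contra hh
          exact hj (key j (by omega)).symm
      · right
        refine ⟨fun j => ?_, fun j hj => ?_⟩
        · by_cases hj : (j : ℕ) = cls ν
          · have : j = ⟨cls ν, hc⟩ := Fin.ext hj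
            rw [this]; exact h
          · exact (key j hj).ge
        · by_contra hh
          exact hj (key j (by omega))
    · left
      have : μ = ν := Finsupp.ext fun j => key j (by have := j.2; omega)
      rw [this]; exact invDiv_refl _

theorem invDiv_comparable {n : ℕ} {μ ν ρ : Fin n →₀ ℕ} (h1 : InvDiv μ ρ) (h2 : InvDiv ν ρ) :
    InvDiv μ ν ∨ InvDiv ν μ := by
  rcases le_total (cls μ) (cls ν) with h | h
  · exact invDiv_comparable_aux h1 h2 h
  · exact (invDiv_comparable_aux h2 h1 h).symm

theorem revBig_of_invDiv {n : ℕ} {μ μ' : Fin n →₀ ℕ} {j : Fin n} (hj : cls μ < (j : ℕ))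
    (h : InvDiv μ' (Finsupp.single j 1 + μ)) (hno : InvDiv μ' μ → μ' = μ) : RevBig μ' μ := by
  have e : ∀ i : Fin n, cls μ' < (i : ℕ) → (Finsupp.single j 1 + μ : Fin n →₀ ℕ) i = μ' i := fun i hi => by
    by_contra hh; exact absurd (h.2 i hh) (by omega)
  rcases lt_or_ge (cls μ') (j : ℕ) with hc | hc
  · refine ⟨j, ?_, fun k hk => ?_⟩
    · rw [← e j hc]; simp
    · rw [← e k (hc.trans hk)]; simp [Finsupp.single_apply, hk.ne]
  · have hne : ¬ InvDiv μ' μ := fun hd => by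
      have := hno hd; subst this; omega
    have e' : ∀ i : Fin n, cls μ' < (i : ℕ) → μ' i = μ i := fun i hi => by
      have hji : j ≠ i := fun hh => by subst hh; omega
      rw [← e i hi]; simp [Finsupp.single_apply, hji]
    by_contra hnb
    apply hne
    refine ⟨fun i => ?_, fun i hi => ?_⟩
    · rcases lt_trichotomy (i : ℕ) (cls μ') with hi | hi | hi
      · rw [eq_zero_of_lt_cls hi]; exact Nat.zero_le _
      · by_contra hlt
        exact hnb ⟨i, not_le.mp hlt, fun k hk => e' k (hi ▸ hk)⟩
      · exact (e' i hi).le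
    · by_contra hh
      exact hi (e' i (by omega)).symm

section PB
variable {n : ℕ} {K : Type*} [Field K] (m : MonomialOrder (Fin n))
  (H : Finset (MvPolynomial (Fin n) K))

theorem ldeg_eq (f : MvPolynomial (Fin n) K) : ldeg m f = m.degree f := rfl

/-- involutive representation bounded by `ρ` -/
def InvRep (ρ : m.syn) (f : MvPolynomial (Fin n) K) : Prop :=
  ∃ P : MvPolynomial (Fin n) K → MvPolynomial (Fin n) K,
    (∀ g, g ∉ H → P g = 0) ∧ f = ∑ g ∈ H, P g * g ∧
      ∀ g ∈ H, P g ∈ MvPolynomial.supported K {i : Fin n | (i : ℕ) ≤ cls (ldeg m g)} ∧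
        m.toSyn (ldeg m (P g * g)) ≤ ρ

variable {m H}

theorem InvRep.mono {ρ ρ' : m.syn} {f : MvPolynomial (Fin n) K} (h : InvRep m H ρ f) (hle : ρ ≤ ρ') :
    InvRep m H ρ' f := by
  obtain ⟨P, h0, h1, h2⟩ := h
  exact ⟨P, h0, h1, fun g hg => ⟨(h2 g hg).1, (h2 g hg).2.trans hle⟩⟩

theorem zero_le_syn (ρ : m.syn) : 0 ≤ ρ := bot_le (a := ρ)

theorem rep_zero {ρ : m.syn} : InvRep m H ρ 0 :=
  ⟨0, fun _ _ => rfl, by simp, fun g _ => ⟨Subalgebra.zero_mem _, by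
    simp [ldeg_eq, zero_le_syn]⟩⟩

theorem InvRep.add {ρ : m.syn} {f f' : MvPolynomial (Fin n) K} (h : InvRep m H ρ f)
    (h' : InvRep m H ρ f') : InvRep m H ρ (f + f') := by
  obtain ⟨P, h0, h1, h2⟩ := h
  obtain ⟨P', h0', h1', h2'⟩ := h'
  refine ⟨fun g => P g + P' g, fun g hg => by simp [h0 g hg, h0' g hg], ?_, fun g hg => ⟨
    Subalgebra.add_mem _ (h2 g hg).1 (h2' g hg).1, ?_⟩⟩
  · rw [h1, h1', ← Finset.sum_add_distrib]
    exact Finset.sum_congr rfl fun g _ => (add_mul _ _ _).symm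
  · rw [ldeg_eq, add_mul]
    exact m.degree_add_le.trans (sup_le (h2 g hg).2 (h2' g hg).2)

theorem InvRep.sum {ι : Type*} {s : Finset ι} {ρ : m.syn} {f : ι → MvPolynomial (Fin n) K}
    (h : ∀ i ∈ s, InvRep m H ρ (f i)) : InvRep m H ρ (∑ i ∈ s, f i) :=
  Finset.sum_induction f (InvRep m H ρ) (fun _ _ => InvRep.add) rep_zero h

theorem rep_single {ρ : m.syn} {g p : MvPolynomial (Fin n) K} (hg : g ∈ H)
    (hp : p ∈ MvPolynomial.supported K {i : Fin n | (i : ℕ) ≤ cls (ldeg m g)})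
    (hle : m.toSyn (ldeg m (p * g)) ≤ ρ) : InvRep m H ρ (p * g) := by
  classical
  refine ⟨fun g' => if g' = g then p else 0, fun g' hg' => if_neg (by rintro rfl; exact hg' hg), ?_,
    fun g' _ => ?_⟩
  · rw [Finset.sum_eq_single g]
    · simp
    · intro b _ hb; simp [hb]
    · exact fun h => absurd hg h
  · by_cases h : g' = g
    · subst h; simpa using ⟨hp, hle⟩
    · simp only [h, if_false]
      exact ⟨Subalgebra.zero_mem _, by simp [ldeg_eq, zero_le_syn]⟩

theorem InvRep.smul {ρ : m.syn} {f : MvPolynomial (Fin n) K} (c : K) (h : InvRep m H ρ f) :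
    InvRep m H ρ (c • f) := by
  obtain ⟨P, h0, h1, h2⟩ := h
  refine ⟨fun g => c • P g, fun g hg => by simp [h0 g hg], ?_, fun g hg => ⟨
    Subalgebra.smul_mem _ (h2 g hg).1 c, ?_⟩⟩
  · rw [h1, Finset.smul_sum]
    exact Finset.sum_congr rfl fun g _ => (smul_mul_assoc _ _ _).symm
  · rw [ldeg_eq, smul_mul_assoc]
    exact m.degree_smul_le.trans (h2 g hg).2

theorem monomial_mem_supported {σ : Fin n →₀ ℕ} {s : Set (Fin n)} {c : K}
    (h : ∀ j, σ j ≠ 0 → j ∈ s) : monomial σ c ∈ MvPolynomial.supported K s := by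
  rw [mem_supported]
  intro j hj
  by_cases hc : c = 0
  · simp [hc] at hj
  · rw [vars_monomial hc] at hj
    exact h j (by simpa using hj)

theorem mult_of_mem_support {p : MvPolynomial (Fin n) K} {s : Set (Fin n)}
    (hp : p ∈ MvPolynomial.supported K s) {σ : Fin n →₀ ℕ} (hσ : σ ∈ p.support) (j : Fin n)
    (hj : σ j ≠ 0) : j ∈ s := by
  rw [mem_supported] at hp
  exact hp ((mem_vars j).2 ⟨σ, hσ, by simpa using hj⟩)

theorem degree_monomial_mul {f : MvPolynomial (Fin n) K} (hf : f ≠ 0) (ν : Fin n →₀ ℕ) {c : K}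
    (hc : c ≠ 0) : m.degree (monomial ν c * f) = ν + m.degree f := by
  classical
  rw [m.degree_mul (by simpa using hc) hf, m.degree_monomial, if_neg hc]

/-- any nonzero polynomial with an involutive representation has an involutively divisible
leading exponent -/
theorem rep_ldeg (hH0 : ∀ h ∈ H, h ≠ 0)
    (hnodiv : ∀ h ∈ H, ∀ g ∈ H, h ≠ g → ¬ InvDiv (ldeg m h) (ldeg m g))
    {ρ : m.syn} {f : MvPolynomial (Fin n) K} (hf : f ≠ 0) (h : InvRep m H ρ f) :
    ∃ g ∈ H, InvDiv (ldeg m g) (ldeg m f) := by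
  classical
  obtain ⟨P, -, h1, h2⟩ := h
  set S := H.filter fun g => P g ≠ 0 with hS
  have hfS : f = ∑ g ∈ S, P g * g := by
    rw [h1, hS, Finset.sum_filter]
    refine Finset.sum_congr rfl fun g _ => ?_
    by_cases hg : P g = 0 <;> simp [hg]
  have hSne : S.Nonempty := by
    by_contra hne
    rw [Finset.not_nonempty_iff_eq_empty] at hne
    rw [hne] at hfS
    exact hf (by simpa using hfS)
  have hdiv : ∀ g ∈ S, InvDiv (ldeg m g) (m.degree (P g * g)) := by
    intro g hg
    obtain ⟨hgH, hg0⟩ := Finset.mem_filter.1 hg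
    rw [m.degree_mul hg0 (hH0 g hgH)]
    exact invDiv_add fun j hj =>
      mult_of_mem_support (h2 g hgH).1 (m.degree_mem_support hg0) j hj
  obtain ⟨g0, hg0, hmax⟩ := S.exists_max_image (fun g => m.toSyn (m.degree (P g * g))) hSne
  obtain ⟨hg0H, hg00⟩ := Finset.mem_filter.1 hg0
  refine ⟨g0, hg0H, ?_⟩
  suffices hd : m.degree f = m.degree (P g0 * g0) by
    rw [ldeg_eq m f, hd]; exact hdiv g0 hg0
  have hlt : ∀ g ∈ S, g ≠ g0 → m.toSyn (m.degree (P g * g)) < m.toSyn (m.degree (P g0 * g0)) := by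
    intro g hg hne
    refine lt_of_le_of_ne (hmax g hg) fun heq => ?_
    have heq' := m.toSyn.injective heq
    have hgH := (Finset.mem_filter.1 hg).1
    have a := hdiv g hg
    rw [heq'] at a
    rcases invDiv_comparable a (hdiv g0 hg0) with h | h
    · exact hnodiv g hgH g0 hg0H hne h
    · exact hnodiv g0 hg0H g hgH (Ne.symm hne) h
  have hcoeff : f.coeff (m.degree (P g0 * g0)) ≠ 0 := by
    rw [hfS, coeff_sum, Finset.sum_eq_single g0]
    · exact m.coeff_degree_ne_zero_iff.2 (mul_ne_zero hg00 (hH0 g0 hg0H))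
    · intro g hg hne
      exact m.coeff_eq_zero_of_lt (hlt g hg hne)
    · exact fun h => absurd hg0 h
  apply m.toSyn.injective
  refine le_antisymm ?_ (m.le_degree (mem_support_iff.2 hcoeff))
  rw [hfS]
  refine m.degree_sum_le.trans (Finset.sup_le fun g hg => hmax g hg)

theorem rep_monomial_mul (hH0 : ∀ h ∈ H, h ≠ 0)
    (hnodiv : ∀ h ∈ H, ∀ g ∈ H, h ≠ g → ¬ InvDiv (ldeg m h) (ldeg m g))
    (hloc : ∀ h ∈ H, ∀ j : Fin n, cls (ldeg m h) < (j : ℕ) →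
      InvRep m H (m.toSyn (ldeg m (X j * h))) (X j * h)) (ρ : m.syn) :
    ∀ h : H, ∀ ν : Fin n →₀ ℕ, m.toSyn (ν + ldeg m h.1) = ρ →
      InvRep m H ρ (monomial ν (1 : K) * h.1) := by
  classical
  induction ρ using WellFoundedLT.induction with
  | ind ρ IH =>
  let r : H → H → Prop := fun g h => RevBig (ldeg m g.1) (ldeg m h.1)
  haveI : IsTrans H r := ⟨fun _ _ _ => RevBig.trans⟩
  haveI : Std.Irrefl r := ⟨fun _ => RevBig.irrefl⟩
  have wf : WellFounded r := Finite.wellFounded_of_trans_of_irrefl r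
  intro h
  induction h using wf.induction with
  | h h ih =>
  intro ν hν
  by_cases hmul : ∀ j : Fin n, ν j ≠ 0 → (j : ℕ) ≤ cls (ldeg m h.1)
  · refine rep_single h.2 (monomial_mem_supported hmul) ?_
    rw [ldeg_eq, degree_monomial_mul (hH0 _ h.2) _ one_ne_zero, ← hν, ldeg_eq]
  · push Not at hmul
    obtain ⟨j, hj0, hj⟩ := hmul
    obtain ⟨P, -, h1, h2⟩ := hloc h.1 h.2 j hj
    obtain ⟨τ, hτ⟩ : ∃ τ, ν = τ + Finsupp.single j 1 :=
      ⟨ν - Finsupp.single j 1, (tsub_add_cancel_of_le (by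
        rw [Finsupp.single_le_iff]; omega)).symm⟩
    have hXdeg : ldeg m (X j * h.1) = Finsupp.single j 1 + ldeg m h.1 := by
      rw [ldeg_eq, X, degree_monomial_mul (hH0 _ h.2) _ one_ne_zero, ldeg_eq]
    have hexp : monomial ν (1 : K) * h.1 =
        ∑ g ∈ H, ∑ σ ∈ (P g).support, (P g).coeff σ • (monomial (τ + σ) (1 : K) * g) := by
      have : monomial ν (1 : K) = monomial τ 1 * X j := by
        rw [X, monomial_mul, hτ, one_mul]
      rw [this, mul_assoc, h1, Finset.mul_sum]
      refine Finset.sum_congr rfl fun g _ => ?_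
      conv_lhs => rw [(P g).as_sum]
      rw [Finset.sum_mul, Finset.mul_sum]
      refine Finset.sum_congr rfl fun σ _ => ?_
      rw [← mul_assoc, monomial_mul, ← smul_mul_assoc, smul_monomial]
      simp
    rw [hexp]
    refine InvRep.sum fun g hg => InvRep.sum fun σ hσ => InvRep.smul _ ?_
    have hP0 : P g ≠ 0 := by rintro h0; simp [h0] at hσ
    have hle1 : m.toSyn (σ + ldeg m g) ≤ m.toSyn (Finsupp.single j 1 + ldeg m h.1) := by
      rw [← hXdeg]
      refine le_trans ?_ (h2 g hg).2
      rw [ldeg_eq, ldeg_eq, m.degree_mul hP0 (hH0 g hg), map_add, map_add]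
      exact add_le_add_left (m.le_degree hσ) _
    have hρ : ρ = m.toSyn τ + m.toSyn (Finsupp.single j 1 + ldeg m h.1) := by
      rw [← hν, hτ, ← map_add, add_assoc]
    have hs : m.toSyn (τ + σ + ldeg m g) = m.toSyn τ + m.toSyn (σ + ldeg m g) := by
      rw [← map_add, add_assoc]
    rcases hle1.lt_or_eq with hlt | heq
    · have hlt' : m.toSyn (τ + σ + ldeg m g) < ρ := by
        rw [hs, hρ]; exact add_lt_add_right hlt _
      exact (IH _ hlt' ⟨g, hg⟩ (τ + σ) rfl).mono hlt'.le
    · refine ih ⟨g, hg⟩ ?_ (τ + σ) (by rw [hs, hρ, heq])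
      have heq' := m.toSyn.injective heq
      refine revBig_of_invDiv hj ?_ fun hd => ?_
      · rw [← heq']
        exact invDiv_add fun i hi => mult_of_mem_support (h2 g hg).1 hσ i hi
      · by_contra hne
        exact hnodiv g hg h.1 h.2 (fun e => hne (congrArg (ldeg m) e)) hd

theorem rep_of_mem_span (hH0 : ∀ h ∈ H, h ≠ 0)
    (hnodiv : ∀ h ∈ H, ∀ g ∈ H, h ≠ g → ¬ InvDiv (ldeg m h) (ldeg m g))
    (hloc : ∀ h ∈ H, ∀ j : Fin n, cls (ldeg m h) < (j : ℕ) →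
      InvRep m H (m.toSyn (ldeg m (X j * h))) (X j * h)) {f : MvPolynomial (Fin n) K}
    (hf : f ∈ Ideal.span (↑H : Set (MvPolynomial (Fin n) K))) : ∃ ρ, InvRep m H ρ f := by
  classical
  obtain ⟨a, -, rfl⟩ := Submodule.mem_span_finset.1 hf
  have hadd : ∀ f g : MvPolynomial (Fin n) K, (∃ ρ, InvRep m H ρ f) → (∃ ρ, InvRep m H ρ g) →
      ∃ ρ, InvRep m H ρ (f + g) := by
    rintro f g ⟨ρ, h⟩ ⟨ρ', h'⟩
    exact ⟨max ρ ρ', (h.mono (le_max_left _ _)).add (h'.mono (le_max_right _ _))⟩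
  refine Finset.sum_induction _ (fun f => ∃ ρ, InvRep m H ρ f) hadd ⟨0, rep_zero⟩ fun h hh => ?_
  have : a h • h = ∑ σ ∈ (a h).support, (a h).coeff σ • (monomial σ (1 : K) * h) := by
    conv_lhs => rw [(a h).as_sum]
    rw [smul_eq_mul, Finset.sum_mul]
    refine Finset.sum_congr rfl fun σ _ => ?_
    rw [← smul_mul_assoc, smul_monomial]
    simp
  rw [this]
  refine Finset.sum_induction _ (fun f => ∃ ρ, InvRep m H ρ f) hadd ⟨0, rep_zero⟩ fun σ _ => ?_
  exact ⟨_, (rep_monomial_mul hH0 hnodiv hloc _ ⟨h, hh⟩ σ rfl).smul _⟩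

theorem rep_of_isPB {I : Ideal (MvPolynomial (Fin n) K)} (hPB : IsPB m H I) (ρ : m.syn) :
    ∀ f ∈ I, m.toSyn (m.degree f) = ρ → InvRep m H ρ f := by
  classical
  obtain ⟨hHI, hH0, -, -, -, huniq⟩ := hPB
  induction ρ using WellFoundedLT.induction with
  | ind ρ IH =>
  intro f hf hρ
  by_cases hf0 : f = 0
  · rw [hf0]; exact rep_zero
  obtain ⟨_, ⟨⟨g, hg, rfl⟩, hdiv⟩, -⟩ := huniq (ldeg m f) (Ideal.subset_span ⟨f, hf, hf0, rfl⟩)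
  have hg : g ∈ H := hg
  have hg0 := hH0 g hg
  simp only [ldeg_eq] at hdiv
  set c := m.leadingCoeff f / m.leadingCoeff g with hc
  have hlg : m.leadingCoeff g ≠ 0 := m.leadingCoeff_ne_zero_iff.2 hg0
  have hc0 : c ≠ 0 := div_ne_zero (m.leadingCoeff_ne_zero_iff.2 hf0) hlg
  set τ := m.degree f - m.degree g with hτ
  have hτg : τ + m.degree g = m.degree f := tsub_add_cancel_of_le hdiv.1
  have hdeg : m.degree (monomial τ c * g) = m.degree f := by
    rw [degree_monomial_mul hg0 _ hc0, hτg]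
  have hcoef : (f - monomial τ c * g).coeff (m.degree f) = 0 := by
    rw [coeff_sub, ← hτg, coeff_monomial_mul, hτg, hc]
    change m.leadingCoeff f - m.leadingCoeff f / m.leadingCoeff g * m.leadingCoeff g = 0
    rw [div_mul_cancel₀ _ hlg, sub_self]
  have hle : m.toSyn (m.degree (f - monomial τ c * g)) ≤ m.toSyn (m.degree f) := by
    refine m.degree_sub_le.trans (sup_le le_rfl ?_)
    rw [hdeg]
  have h1 : InvRep m H ρ (f - monomial τ c * g) := by
    by_cases h0 : f - monomial τ c * g = 0
    · rw [h0]; exact rep_zero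
    have hlt : m.toSyn (m.degree (f - monomial τ c * g)) < ρ := by
      rw [← hρ]
      refine lt_of_le_of_ne hle fun he => ?_
      have := m.coeff_degree_ne_zero_iff.2 h0
      rw [m.toSyn.injective he] at this
      exact this hcoef
    exact (IH _ hlt _ (I.sub_mem hf (I.mul_mem_left _ (hHI g hg))) rfl).mono hlt.le
  have h2 : InvRep m H ρ (monomial τ c * g) := by
    refine rep_single hg (monomial_mem_supported fun j hj => hdiv.2 j fun he => hj ?_) ?_
    · simp [hτ, he]
    · rw [ldeg_eq, hdeg, hρ]
  simpa using h1.add h2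

end PB

/-- Prop. 2.3: if no leading term of `H` involutively divides another one,
then `H` is a Pommaret basis of `⟨H⟩` iff every non-multiplicative product `x_j · h` has an
involutive standard representation with respect to `H`. -/
theorem statement1 {n : ℕ} {K : Type*} [Field K] (m : MonomialOrder (Fin n))
    (H : Finset (MvPolynomial (Fin n) K)) (hH0 : ∀ h ∈ H, h ≠ 0)
    (hnodiv : ∀ h ∈ H, ∀ g ∈ H, h ≠ g → ¬ InvDiv (ldeg m h) (ldeg m g)) :
    IsPB m H (Ideal.span (↑H : Set (MvPolynomial (Fin n) K))) ↔
      ∀ h ∈ H, ∀ j : Fin n, cls (ldeg m h) < (j : ℕ) →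
        ∃ P : MvPolynomial (Fin n) K → MvPolynomial (Fin n) K,
          (∀ g, g ∉ H → P g = 0) ∧ X j * h = ∑ g ∈ H, P g * g ∧
          ∀ g ∈ H, P g ≠ 0 →
            P g ∈ MvPolynomial.supported K {i : Fin n | (i : ℕ) ≤ cls (ldeg m g)} ∧
            m.toSyn (ldeg m (P g * g)) ≤ m.toSyn (ldeg m (X j * h)) := by
  constructor
  · intro hPB h hh j hj
    obtain ⟨P, h0, h1, h2⟩ := rep_of_isPB hPB _ (X j * h)
      (Ideal.mul_mem_left _ _ (Ideal.subset_span hh)) rfl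
    exact ⟨P, h0, h1, fun g hg _ => h2 g hg⟩
  · intro hloc'
    have hloc : ∀ h ∈ H, ∀ j : Fin n, cls (ldeg m h) < (j : ℕ) →
        InvRep m H (m.toSyn (ldeg m (X j * h))) (X j * h) := by
      intro h hh j hj
      obtain ⟨P, h0, h1, h2⟩ := hloc' h hh j hj
      refine ⟨P, h0, h1, fun g hg => ?_⟩
      by_cases hP : P g = 0
      · rw [hP]
        exact ⟨Subalgebra.zero_mem _, by simp [ldeg_eq, zero_le_syn]⟩
      · exact h2 g hg hP
    have hinv : ∀ f ∈ Ideal.span (↑H : Set (MvPolynomial (Fin n) K)), f ≠ 0 →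
        ∃ g ∈ H, InvDiv (ldeg m g) (ldeg m f) := fun f hf hf0 => by
      obtain ⟨ρ, hρ⟩ := rep_of_mem_span hH0 hnodiv hloc hf
      exact rep_ldeg hH0 hnodiv hf0 hρ
    have hspan : ltIdeal m (Ideal.span (↑H : Set (MvPolynomial (Fin n) K))) =
        Ideal.span ((fun μ => monomial μ (1 : K)) ''
          ((fun h : MvPolynomial (Fin n) K => ldeg m h) '' ↑H)) := by
      apply le_antisymm
      · refine Ideal.span_le.2 ?_
        rintro _ ⟨f, hf, hf0, rfl⟩
        obtain ⟨g, hg, hd⟩ := hinv f hf hf0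
        refine mem_ideal_span_monomial_image.2 fun ξ hξ => ?_
        have : ξ = ldeg m f := by
          have := support_monomial_subset hξ
          simpa using this
        exact ⟨ldeg m g, ⟨g, hg, rfl⟩, this ▸ hd.1⟩
      · refine Ideal.span_mono ?_
        rintro _ ⟨_, ⟨g, hg, rfl⟩, rfl⟩
        exact ⟨g, Ideal.subset_span hg, hH0 g hg, rfl⟩
    refine ⟨fun h hh => Ideal.subset_span hh, hH0, ?_, H.finite_toSet.image _, hspan, ?_⟩
    · intro h hh g hg he
      by_contra hne
      refine hnodiv h hh g hg hne ?_
      have he : ldeg m h = ldeg m g := he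
      rw [he]
      exact invDiv_refl _
    · intro ν hν
      rw [hspan, mem_ideal_span_monomial_image] at hν
      obtain ⟨_, ⟨g, hg, rfl⟩, hle⟩ := hν ν (by simp)
      have hg : g ∈ H := hg
      have hle : m.degree g ≤ ν := hle
      have hd : ldeg m (monomial (ν - m.degree g) (1 : K) * g) = ν := by
        rw [ldeg_eq, degree_monomial_mul (hH0 g hg) _ one_ne_zero, tsub_add_cancel_of_le hle]
      obtain ⟨h, hh, hdiv⟩ := hinv (monomial (ν - m.degree g) (1 : K) * g)
        (Ideal.mul_mem_left _ _ (Ideal.subset_span hg))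
        (mul_ne_zero (by simp) (hH0 g hg))
      rw [hd] at hdiv
      refine ⟨ldeg m h, ⟨⟨h, hh, rfl⟩, hdiv⟩, ?_⟩
      rintro _ ⟨⟨h', hh', rfl⟩, hdiv'⟩
      by_contra hne
      have hne' : h' ≠ h := fun e => hne (by rw [e])
      rcases invDiv_comparable hdiv hdiv' with hc | hc
      · exact hnodiv h hh h' hh' hne'.symm hc
      · exact hnodiv h' hh' h hh hne' hc
end

section
/- Let H be a Pommaret basis of the proper nonzero homogeneous ideal I of P for the reverse lexicographic order and let d = min_{h∈H} cls(h) be the minimal class of a generator in H. Then x_1,…,x_{d−1} is a P/I-regular sequence, and it is maximal: there is no P/I-regular sequence of length d consisting of homogeneous elements of the maximal ideal ⟨x_1,…,x_n⟩; in particular depth(P/I) = d−1. -/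
open MvPolynomial

/-- The homogeneous maximal ideal `⟨x_1, …, x_n⟩`. -/
noncomputable def mxI (n : ℕ) (K : Type*) [Field K] : Ideal (MvPolynomial (Fin n) K) :=
  Ideal.span (Set.range X)

/-- The saturation `I : ⟨x_1,…,x_n⟩^∞` of `I`, as a set. -/
def satSet {n : ℕ} {K : Type*} [Field K] (I : Ideal (MvPolynomial (Fin n) K)) :
    Set (MvPolynomial (Fin n) K) :=
  {f | ∃ s : ℕ, ∀ g ∈ (mxI n K ^ s : Ideal (MvPolynomial (Fin n) K)), g * f ∈ I}

universe v

section
open CategoryTheory Abelian Limits RingTheory.Sequence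

theorem ext_descend {R : Type*} [CommRing R] [Small.{v} R] (N : ModuleCat.{v} R) (rs : List R) :
    ∀ (M : Type v) [AddCommGroup M] [Module R M], IsWeaklyRegular M rs →
      (∀ i < rs.length + 1, Subsingleton (Ext N (ModuleCat.of R M) i)) →
      Subsingleton (N →ₗ[R] (M ⧸ (Ideal.ofList rs • ⊤ : Submodule R M))) := by
  induction rs with
  | nil =>
    intro M _ _ _ h
    have h0 : Subsingleton (N ⟶ ModuleCat.of R M) :=
      Ext.addEquiv₀.subsingleton_congr.mp (h 0 (by simp))
    have h1 : Subsingleton (N →ₗ[R] M) :=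
      (ModuleCat.homAddEquiv (M := N) (N := ModuleCat.of R M)).symm.subsingleton
    have e : (M ⧸ (Ideal.ofList ([] : List R) • ⊤ : Submodule R M)) ≃ₗ[R] M :=
      Submodule.quotEquivOfEqBot _ (by simp)
    refine ⟨fun a b => ?_⟩
    have := Subsingleton.elim (e.toLinearMap ∘ₗ a) (e.toLinearMap ∘ₗ b)
    ext x
    apply e.injective
    exact LinearMap.congr_fun this x
  | cons x rs ih =>
    intro M _ _ hreg h
    rw [isWeaklyRegular_cons_iff] at hreg
    have h2 := ih (QuotSMulTop x M) hreg.2 (by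
      intro i hi
      have hx : IsSMulRegular (ModuleCat.of R M) x := hreg.1
      have zero1 := AddCommGrpCat.isZero_of_iff_subsingleton.mpr (h i (by simp; omega))
      have zero2 := AddCommGrpCat.isZero_of_iff_subsingleton.mpr (h (i + 1) (by simp; omega))
      exact AddCommGrpCat.subsingleton_of_isZero <| ShortComplex.Exact.isZero_of_both_zeros
        ((Ext.covariant_sequence_exact₃' N hx.smulShortComplex_shortExact) i (i + 1) rfl)
        (zero1.eq_zero_of_src _) (zero2.eq_zero_of_tgt _))
    have e := Submodule.quotOfListConsSMulTopEquivQuotSMulTopInner M x rs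
    refine ⟨fun a b => ?_⟩
    have := Subsingleton.elim (e.toLinearMap ∘ₗ a) (e.toLinearMap ∘ₗ b)
    ext y
    apply e.injective
    exact LinearMap.congr_fun this y

theorem mk_mem_smul_top {R : Type*} [CommRing R] (I A : Ideal R) (f : R) :
    (Submodule.Quotient.mk f : R ⧸ I) ∈ (A • ⊤ : Submodule R (R ⧸ I)) ↔ f ∈ I ⊔ A := by
  have h1 : (A • ⊤ : Submodule R (R ⧸ I)) = Submodule.map (Submodule.mkQ I) A := by
    have := Submodule.map_smul'' A (⊤ : Submodule R R) (Submodule.mkQ I)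
    rw [Submodule.map_top, Submodule.range_mkQ] at this
    rw [← this]; simp
  rw [h1, ← Submodule.comap_map_mkQ]; rfl

theorem smulRegular_quot {R : Type*} [CommRing R] (I A : Ideal R) (r : R)
    (h : ∀ f, r * f ∈ I ⊔ A → f ∈ I ⊔ A) :
    IsSMulRegular ((R ⧸ I) ⧸ (A • ⊤ : Submodule R (R ⧸ I))) r := by
  rw [isSMulRegular_iff_right_eq_zero_of_smul]
  intro x hx
  obtain ⟨x, rfl⟩ := Submodule.Quotient.mk_surjective _ x
  obtain ⟨f, rfl⟩ := Submodule.Quotient.mk_surjective _ x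
  rw [← Submodule.Quotient.mk_smul, ← Submodule.Quotient.mk_smul,
    Submodule.Quotient.mk_eq_zero, mk_mem_smul_top] at hx
  rw [Submodule.Quotient.mk_eq_zero, mk_mem_smul_top]
  exact h f hx

theorem weaklyRegular_ofFn {R : Type*} [CommRing R] (I : Ideal R) {k : ℕ} (g : Fin k → R)
    (h : ∀ i : Fin k, ∀ f, g i * f ∈ I ⊔ Ideal.span {p | ∃ j : Fin k, j < i ∧ p = g j} →
      f ∈ I ⊔ Ideal.span {p | ∃ j : Fin k, j < i ∧ p = g j}) :
    IsWeaklyRegular (R ⧸ I) (List.ofFn g) := by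
  constructor
  intro i hi
  have hi' : i < k := by simpa using hi
  have h1 : Ideal.ofList ((List.ofFn g).take i) =
      Ideal.span {p | ∃ j : Fin k, j < ⟨i, hi'⟩ ∧ p = g j} := by
    unfold Ideal.ofList
    congr 1
    ext p
    simp only [Set.mem_ofPred_eq, List.mem_take_iff_getElem]
    constructor
    · rintro ⟨j, hj, rfl⟩
      simp at hj
      exact ⟨⟨j, hj.2⟩, hj.1, by simp⟩
    · rintro ⟨j, hj, rfl⟩
      exact ⟨j, by simp; exact hj, by simp⟩
  rw [h1]
  have := h ⟨i, hi'⟩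
  simp only [List.getElem_ofFn]
  exact smulRegular_quot _ _ _ this

theorem ofList_ofFn {R : Type*} [CommRing R] {k : ℕ} (g : Fin k → R) :
    Ideal.ofList (List.ofFn g) = Ideal.span (Set.range g) := by
  unfold Ideal.ofList
  congr 1
  ext p; simp [List.mem_ofFn]

/-- The depth comparison, from Mathlib's version of Rees' theorem. -/
theorem depth_contra {R : Type*} [CommRing R] [IsNoetherianRing R] (I mm : Ideal R)
    (hI : I ≤ mm) (hm : mm ≠ ⊤) {k : ℕ} (x : Fin k → R) (g : Fin (k + 1) → R)
    (hx : ∀ i : Fin k, ∀ f, x i * f ∈ I ⊔ Ideal.span {p | ∃ j : Fin k, j < i ∧ p = x j} →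
      f ∈ I ⊔ Ideal.span {p | ∃ j : Fin k, j < i ∧ p = x j})
    (hg : ∀ i : Fin (k + 1), ∀ f,
      g i * f ∈ I ⊔ Ideal.span {p | ∃ j : Fin (k + 1), j < i ∧ p = g j} →
      f ∈ I ⊔ Ideal.span {p | ∃ j : Fin (k + 1), j < i ∧ p = g j})
    (hgm : ∀ i, g i ∈ mm) (hgt : I ⊔ Ideal.span (Set.range g) ≠ ⊤)
    (s : R) (hs : s ∉ I ⊔ Ideal.span (Set.range x))
    (hs' : ∀ a ∈ mm, a * s ∈ I ⊔ Ideal.span (Set.range x)) : False := by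
  have hWx := weaklyRegular_ofFn I x hx
  have hWg := weaklyRegular_ofFn I g hg
  have hne : ∀ A : Ideal R, I ⊔ A ≠ ⊤ → (A • ⊤ : Submodule R (R ⧸ I)) ≠ ⊤ := by
    intro A hA h
    apply hA
    rw [Ideal.eq_top_iff_one, ← mk_mem_smul_top, h]
    trivial
  have hRg : IsRegular (R ⧸ I) (List.ofFn g) := by
    refine ⟨hWg, ?_⟩
    rw [ofList_ofFn]
    exact (hne _ hgt).symm
  have hext := ModuleCat.subsingleton_ext_of_exists_isRegular mm (ModuleCat.of R (R ⧸ mm))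
    (by
      change Module.support R (R ⧸ mm) ⊆ _
      rw [Module.support_eq_zeroLocus, Ideal.annihilator_quotient]) (ModuleCat.of R (R ⧸ I))
    (lt_top_iff_ne_top.2 (hne _ (by rwa [sup_eq_right.2 hI]))) (List.ofFn g)
    (by intro r hr; rw [List.mem_ofFn] at hr; obtain ⟨i, rfl⟩ := hr; exact hgm i) hRg
  have hsub := ext_descend (ModuleCat.of R (R ⧸ mm)) (List.ofFn x) (R ⧸ I) hWx
    (by simpa using hext)
  rw [ofList_ofFn] at hsub
  let y : (R ⧸ I) ⧸ (Ideal.span (Set.range x) • ⊤ : Submodule R (R ⧸ I)) :=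
    Submodule.Quotient.mk (Submodule.Quotient.mk s)
  let φ : (R ⧸ mm) →ₗ[R] (R ⧸ I) ⧸ (Ideal.span (Set.range x) • ⊤ : Submodule R (R ⧸ I)) :=
    Submodule.liftQ mm (LinearMap.toSpanSingleton R _ y) (by
      intro a ha
      rw [LinearMap.mem_ker, LinearMap.toSpanSingleton_apply]
      change a • Submodule.Quotient.mk (Submodule.Quotient.mk s) = _
      rw [← Submodule.Quotient.mk_smul, ← Submodule.Quotient.mk_smul,
        Submodule.Quotient.mk_eq_zero, mk_mem_smul_top]
      exact hs' a ha)
  have h0 : φ = 0 := Subsingleton.elim (α := (R ⧸ mm) →ₗ[R] _) φ 0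
  have h1 : φ (Submodule.Quotient.mk 1) = 0 := by rw [h0]; rfl
  have h2 : φ (Submodule.Quotient.mk 1) = y := by
    change LinearMap.toSpanSingleton R _ y 1 = y
    rw [LinearMap.toSpanSingleton_apply, one_smul]
  rw [h2, Submodule.Quotient.mk_eq_zero, mk_mem_smul_top] at h1
  exact hs h1
end

section
variable {n : ℕ} {K : Type*} [Field K]

/-- All monomials of `r` are standard, i.e. not divisible by a monomial in `L`. -/
def IsStd (L : Set (Fin n →₀ ℕ)) (r : MvPolynomial (Fin n) K) : Prop :=
  ∀ c ∈ r.support, ∀ μ ∈ L, ¬ μ ≤ c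

/-- The ideal generated by the first `i` variables. -/
noncomputable def varI (n : ℕ) (K : Type*) [Field K] (i : ℕ) : Ideal (MvPolynomial (Fin n) K) :=
  Ideal.span {p | ∃ j : Fin n, (j : ℕ) < i ∧ p = X j}

theorem mem_varI (i : ℕ) (f : MvPolynomial (Fin n) K) :
    f ∈ varI n K i ↔ ∀ c ∈ f.support, ∃ j : Fin n, (j : ℕ) < i ∧ c j ≠ 0 := by
  have : {p : MvPolynomial (Fin n) K | ∃ j : Fin n, (j : ℕ) < i ∧ p = X j} =
      X '' {j : Fin n | (j : ℕ) < i} := by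
    ext p
    constructor
    · rintro ⟨j, hj, rfl⟩; exact ⟨j, hj, rfl⟩
    · rintro ⟨j, hj, rfl⟩; exact ⟨j, hj, rfl⟩
  unfold varI
  rw [this, mem_ideal_span_X_image]
  rfl

theorem coeff_X_mul_ne {k : Fin n} {f : MvPolynomial (Fin n) K} {c : Fin n →₀ ℕ}
    (hc : c ∈ (X k * f).support) : ∃ b ∈ f.support, c = b + Finsupp.single k 1 := by
  classical
  rw [mem_support_iff, coeff_X_mul'] at hc
  split_ifs at hc with h
  · refine ⟨c - Finsupp.single k 1, mem_support_iff.2 hc, ?_⟩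
    rw [tsub_add_cancel_of_le]
    rw [Finsupp.single_le_iff]
    rw [Finsupp.mem_support_iff] at h
    omega
  · exact absurd rfl hc

theorem IsStd.X_mul {L : Set (Fin n →₀ ℕ)} {r : MvPolynomial (Fin n) K} (hr : IsStd L r)
    (k : Fin n) (hL : ∀ μ ∈ L, μ k = 0) : IsStd L (X k * r) := by
  intro c hc μ hμ hle
  obtain ⟨b, hb, rfl⟩ := coeff_X_mul_ne hc
  apply hr b hb μ hμ
  intro j
  by_cases hj : j = k
  · subst hj; rw [hL μ hμ]; exact Nat.zero_le _
  · have := hle j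
    simpa [Finsupp.single_apply, Ne.symm hj] using this

theorem IsStd.add {L : Set (Fin n →₀ ℕ)} {r s : MvPolynomial (Fin n) K} (hr : IsStd L r)
    (hs : IsStd L s) : IsStd L (r + s) := by
  classical
  intro c hc
  rcases Finset.mem_union.1 (support_add hc) with h | h
  · exact hr c h
  · exact hs c h

theorem IsStd.sub {L : Set (Fin n →₀ ℕ)} {r s : MvPolynomial (Fin n) K} (hr : IsStd L r)
    (hs : IsStd L s) : IsStd L (r - s) := by
  classical
  intro c hc
  rcases Finset.mem_union.1 (support_sub _ _ _ hc) with h | h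
  · exact hr c h
  · exact hs c h

/-- Normal forms of elements of `I + (x_1, …, x_i)` lie in `(x_1, …, x_i)`. -/
theorem nf_mem_varI {L : Set (Fin n →₀ ℕ)} {I : Ideal (MvPolynomial (Fin n) K)}
    (F1 : ∀ f, ∃ r, IsStd L r ∧ f - r ∈ I) (F2 : ∀ r ∈ I, IsStd L r → r = 0)
    {i : ℕ} (F3 : ∀ μ ∈ L, ∀ j : Fin n, (j : ℕ) < i → μ j = 0)
    {f r : MvPolynomial (Fin n) K} (hf : f ∈ I ⊔ varI n K i) (hr : IsStd L r)
    (hfr : f - r ∈ I) : r ∈ varI n K i := by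
  obtain ⟨g, hg, p, hp, rfl⟩ := Submodule.mem_sup.1 hf
  have key : ∃ r', IsStd L r' ∧ r' ∈ varI n K i ∧ p - r' ∈ I := by
    clear hfr hf
    unfold varI at hp
    induction hp using Submodule.closure_induction with
    | zero => exact ⟨0, by simp [IsStd], zero_mem _, by simp⟩
    | add x y hx hy h1 h2 =>
      obtain ⟨a, ha, ha', ha''⟩ := h1
      obtain ⟨b, hb, hb', hb''⟩ := h2
      refine ⟨a + b, ha.add hb, add_mem ha' hb', ?_⟩
      convert! add_mem ha'' hb'' using 1
      ring
    | smul_mem a x h =>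
      obtain ⟨j, hj, rfl⟩ := h
      obtain ⟨t, ht, ht'⟩ := F1 a
      refine ⟨X j * t, ht.X_mul j (fun μ hμ => F3 μ hμ j hj),
        Ideal.mul_mem_right _ _ (Ideal.subset_span ⟨j, hj, rfl⟩), ?_⟩
      convert! Ideal.mul_mem_left I (X j) ht' using 1
      simp only [smul_eq_mul]; ring
  obtain ⟨r', h1, h2, h3⟩ := key
  have : r - r' = 0 := by
    apply F2 _ _ (hr.sub h1)
    have := sub_mem (add_mem hg h3) hfr
    convert! this using 1
    ring
  rw [sub_eq_zero.1 this]
  exact h2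

theorem regular_part {L : Set (Fin n →₀ ℕ)} {I : Ideal (MvPolynomial (Fin n) K)}
    (F1 : ∀ f, ∃ r, IsStd L r ∧ f - r ∈ I) (F2 : ∀ r ∈ I, IsStd L r → r = 0)
    {d : ℕ} (F3 : ∀ μ ∈ L, ∀ j : Fin n, (j : ℕ) < d → μ j = 0)
    (i : Fin n) (hi : (i : ℕ) < d) (f : MvPolynomial (Fin n) K)
    (hf : X i * f ∈ I ⊔ varI n K i) : f ∈ I ⊔ varI n K i := by
  obtain ⟨r, hr, hr'⟩ := F1 f
  have h1 : X i * r ∈ varI n K i := by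
    refine nf_mem_varI F1 F2 (fun μ hμ j hj => F3 μ hμ j (hj.trans hi)) hf
      (hr.X_mul i fun μ hμ => F3 μ hμ i hi) ?_
    rw [← mul_sub]
    exact Ideal.mul_mem_left _ _ hr'
  have h2 : r ∈ varI n K i := by
    rw [mem_varI] at h1 ⊢
    intro c hc
    obtain ⟨j, hj, hj'⟩ := h1 (Finsupp.single i 1 + c) (by
      rw [mem_support_iff, coeff_X_mul]; exact mem_support_iff.1 hc)
    refine ⟨j, hj, ?_⟩
    have : i ≠ j := by rintro rfl; omega
    simpa [Finsupp.single_apply, this] using hj'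
  rw [← sub_add_cancel f r]
  exact add_mem (Ideal.mem_sup_left hr') (Ideal.mem_sup_right h2)

theorem homComp_mem {I : Ideal (MvPolynomial (Fin n) K)} (hI : IsHomIdeal I)
    {f : MvPolynomial (Fin n) K} (hf : f ∈ I) (q : ℕ) : homogeneousComponent q f ∈ I := by
  obtain ⟨S, hS, rfl⟩ := hI
  let _ : GradedAlgebra (homogeneousSubmodule (Fin n) K) := MvPolynomial.gradedAlgebra
  exact homogeneousComponent_mem_of_mem (Ideal.homogeneous_span _ _ hS) hf q

theorem homNF {L : Set (Fin n →₀ ℕ)} {I : Ideal (MvPolynomial (Fin n) K)} (hI : IsHomIdeal I)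
    (F1 : ∀ f, ∃ r, IsStd L r ∧ f - r ∈ I) {q : ℕ} {f : MvPolynomial (Fin n) K}
    (hf : f.IsHomogeneous q) :
    ∃ r, IsStd L r ∧ f - r ∈ I ∧ r.IsHomogeneous q := by
  obtain ⟨r, hr, hr'⟩ := F1 f
  refine ⟨homogeneousComponent q r, ?_, ?_, homogeneousComponent_isHomogeneous q r⟩
  · intro c hc
    rw [support_homogeneousComponent, Finset.mem_filter] at hc
    exact hr c hc.1
  · have := homComp_mem hI hr' q
    rwa [map_sub, homogeneousComponent_eq_self hf] at this

theorem degree_of_mem {q : ℕ} {f : MvPolynomial (Fin n) K} (hf : f.IsHomogeneous q)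
    {c : Fin n →₀ ℕ} (hc : c ∈ f.support) : c.degree = q := by
  by_contra h
  exact mem_support_iff.1 hc (hf.coeff_eq_zero h)

/-- Splitting off the part of a polynomial which lies in `(x_1, …, x_i)`. -/
theorem split_varI (i : ℕ) (r : MvPolynomial (Fin n) K) :
    ∃ r', (∀ c ∈ r'.support, c ∈ r.support ∧ ∀ j : Fin n, (j : ℕ) < i → c j = 0) ∧
      r - r' ∈ varI n K i := by
  classical
  let p : (Fin n →₀ ℕ) → Prop := fun c => ∀ j : Fin n, (j : ℕ) < i → c j = 0
  let r' : MvPolynomial (Fin n) K := ∑ c ∈ r.support with p c, monomial c (coeff c r)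
  have hc : ∀ c, coeff c r' = if p c then coeff c r else 0 := by
    intro c
    simp only [r', coeff_sum, coeff_monomial, Finset.sum_ite_eq', Finset.mem_filter,
      mem_support_iff]
    by_cases h : p c <;> by_cases h' : coeff c r = 0 <;> simp [h, h']
  refine ⟨r', ?_, ?_⟩
  · intro c h
    rw [mem_support_iff, hc] at h
    split_ifs at h with hp
    · exact ⟨mem_support_iff.2 h, hp⟩
    · exact absurd rfl h
  · rw [mem_varI]
    intro c h
    rw [mem_support_iff, coeff_sub, hc] at h
    split_ifs at h with hp
    · simp at h
    · simp only [p] at hp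
      push Not at hp
      exact hp

theorem socle {L : Set (Fin n →₀ ℕ)} (hLfin : L.Finite)
    {I : Ideal (MvPolynomial (Fin n) K)} (hI : IsHomIdeal I)
    (m : MonomialOrder (Fin n)) (hrev : IsRevLex m)
    (F1 : ∀ f, ∃ r, IsStd L r ∧ f - r ∈ I)
    (F2 : ∀ r ∈ I, r ≠ 0 → ∃ μ ∈ L, μ ≤ m.degree r)
    (c : Fin n) (F3 : ∀ μ ∈ L, ∀ j : Fin n, (j : ℕ) < c → μ j = 0)
    (F3' : ∀ μ ∈ L, (c : ℕ) ≤ cls μ) (hex : ∃ μ ∈ L, μ c ≠ 0)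
    (F4 : ∀ ν, (∃ μ ∈ L, μ ≤ ν) → ∃! μ, μ ∈ L ∧ InvDiv μ ν) :
    ∃ s, s ∉ I ⊔ varI n K c ∧ ∀ k, X k * s ∈ I ⊔ varI n K c := by
  classical
  have F2' : ∀ r ∈ I, IsStd L r → r = 0 := by
    intro r hr hs
    by_contra h0
    obtain ⟨μ, hμ, hle⟩ := F2 r hr h0
    exact hs _ (m.degree_mem_support h0) μ hμ hle
  obtain ⟨μ, ⟨hμL, hμc⟩, hmax⟩ := Set.exists_max_image {μ | μ ∈ L ∧ μ c ≠ 0}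
    (fun μ => μ.degree) (hLfin.subset fun μ h => h.1) hex
  let e : Fin n →₀ ℕ := Finsupp.single c 1
  have heμ : e ≤ μ := by rw [Finsupp.single_le_iff]; omega
  -- the reduced generator with leading monomial `μ`
  obtain ⟨r, hr, hrI, hrh⟩ := homNF hI F1 (f := monomial μ 1) (q := μ.degree)
    (isHomogeneous_monomial _ rfl)
  have hμr : coeff μ r = 0 := by
    by_contra h
    exact hr μ (mem_support_iff.2 h) μ hμL le_rfl
  set p := monomial μ 1 - r with hp
  have hpμ : coeff μ p = 1 := by simp [p, hμr]
  have hp0 : p ≠ 0 := by rintro h; simp [h] at hpμ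
  have hps : ∀ ν ∈ p.support, ν = μ ∨ ν ∈ r.support := by
    intro ν hν
    by_cases h : ν = μ
    · exact Or.inl h
    · right
      rw [mem_support_iff] at hν ⊢
      simpa [p, coeff_monomial, Ne.symm h] using hν
  have hdeg : m.degree p = μ := by
    rcases hps _ (m.degree_mem_support hp0) with h | h
    · exact h
    · obtain ⟨l, hl, hle⟩ := F2 p hrI hp0
      exact absurd hle (hr _ h l hl)
  have hphom : p.IsHomogeneous μ.degree := (isHomogeneous_monomial _ rfl).sub hrh
  have hpterm : ∀ ν ∈ p.support, (∃ j : Fin n, (j : ℕ) < c ∧ ν j ≠ 0) ∨ ν c ≠ 0 := by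
    intro ν hν
    by_cases h : ν = μ
    · subst h; exact Or.inr hμc
    have hle : m.toSyn ν ≤ m.toSyn μ := by
      have := m.le_degree hν
      rwa [hdeg] at this
    have hlt : m.toSyn ν < m.toSyn μ := lt_of_le_of_ne hle fun h' => h (m.toSyn.injective h')
    rw [hrev] at hlt
    have hd : (ν.sum fun _ e => e) = (μ.sum fun _ e => e) := degree_of_mem hphom hν
    rcases hlt with h1 | ⟨-, i, hi, hi'⟩
    · omega
    · rcases lt_trichotomy i c with h2 | h2 | h2
      · exact Or.inl ⟨i, h2, by omega⟩
      · subst h2; right; omega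
      · right; rw [hi' c h2]; exact hμc
  let s := divMonomial p e
  have hs_supp : ∀ b ∈ s.support, e + b ∈ p.support := by
    intro b hb
    rw [mem_support_iff, coeff_divMonomial] at hb
    exact mem_support_iff.2 hb
  have hs_hom : ∀ b ∈ s.support, b.degree + 1 = μ.degree := by
    intro b hb
    have := degree_of_mem hphom (hs_supp b hb)
    rw [map_add, Finsupp.degree_single] at this
    omega
  have hμe : ∀ l ∈ L, ¬ l ≤ μ - e := by
    intro l hl hle
    obtain ⟨ν, ⟨hνL, hν1, hν2⟩, -⟩ := F4 _ ⟨l, hl, hle⟩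
    have h1 : InvDiv ν μ := by
      refine ⟨hν1.trans tsub_le_self, fun j hj => ?_⟩
      by_cases hjc : j = c
      · subst hjc; exact F3' ν hνL
      · apply hν2
        simpa [e, Finsupp.single_apply, Ne.symm hjc] using hj
    have h2 : InvDiv μ μ := ⟨le_rfl, fun j hj => absurd rfl hj⟩
    have h3 := (F4 μ ⟨μ, hμL, le_rfl⟩).unique ⟨hνL, h1⟩ ⟨hμL, h2⟩
    have h4 := hν1 c
    rw [h3] at h4
    simp [e] at h4
    omega
  have hs_std : IsStd L s := by
    intro b hb l hl hle
    rcases hps _ (hs_supp b hb) with h | h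
    · apply hμe l hl
      rw [← h, add_tsub_cancel_left]
      exact hle
    · exact hr _ h l hl (hle.trans le_add_self)
  have hXs : X c * s ∈ I ⊔ varI n K c := by
    have h1 : X c * s + modMonomial p e = p := divMonomial_add_modMonomial p e
    have h2 : modMonomial p e ∈ varI n K c := by
      rw [mem_varI]
      intro b hb
      rw [mem_support_iff] at hb
      have hle : ¬ e ≤ b := fun hle => hb (coeff_modMonomial_of_le _ hle)
      rw [coeff_modMonomial_of_not_le _ hle] at hb
      rcases hpterm b (mem_support_iff.2 hb) with h | h
      · exact h
      · exfalso; apply hle; rw [Finsupp.single_le_iff]; omega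
    rw [eq_sub_of_add_eq h1]
    exact sub_mem (Ideal.mem_sup_left hrI) (Ideal.mem_sup_right h2)
  refine ⟨s, ?_, ?_⟩
  · intro hmem
    have h1 := nf_mem_varI F1 F2' F3 hmem hs_std (by simp)
    rw [mem_varI] at h1
    obtain ⟨j, hj, hj'⟩ := h1 (μ - e) (by
      rw [mem_support_iff, coeff_divMonomial, add_tsub_cancel_of_le heμ, hpμ]
      exact one_ne_zero)
    apply hj'
    have := F3 μ hμL j hj
    simp [this]
  · intro k
    have hkh : (X k * s).IsHomogeneous μ.degree := by
      have : homogeneousComponent μ.degree (X k * s) = X k * s := by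
        ext b
        rw [coeff_homogeneousComponent]
        split_ifs with h
        · rfl
        · by_contra h'
          obtain ⟨a, ha, rfl⟩ := coeff_X_mul_ne (mem_support_iff.2 (Ne.symm h'))
          apply h
          rw [map_add, Finsupp.degree_single]
          exact hs_hom a ha
      rw [← this]
      exact homogeneousComponent_isHomogeneous _ _
    obtain ⟨t, ht, htI, hth⟩ := homNF hI F1 hkh
    obtain ⟨t', ht', htv⟩ := split_varI (c : ℕ) t
    have hXt : X c * t' ∈ I ⊔ varI n K c := by
      have h1 : X c * t' = X k * (X c * s) - X c * (X k * s - t) - X c * (t - t') := by ring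
      rw [h1]
      exact sub_mem (sub_mem (Ideal.mul_mem_left _ _ hXs)
        (Ideal.mul_mem_left _ _ (Ideal.mem_sup_left htI)))
        (Ideal.mul_mem_left _ _ (Ideal.mem_sup_right htv))
    have hstd : IsStd L (X c * t') := by
      intro b hb l hl hle
      obtain ⟨ρ, hρ, rfl⟩ := coeff_X_mul_ne hb
      obtain ⟨hρt, hρ0⟩ := ht' ρ hρ
      obtain ⟨ν, ⟨hνL, hν1, hν2⟩, -⟩ := F4 _ ⟨l, hl, hle⟩
      have hνc : ν c = ρ c + 1 := by
        by_contra hne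
        have h1 := hν1 c
        simp at h1
        apply ht ρ hρt ν hνL
        intro j
        by_cases hjc : j = c
        · subst hjc; omega
        · have := hν1 j
          simpa [Finsupp.single_apply, Ne.symm hjc] using this
      have hcls : cls ν ≤ c := Nat.sInf_le ⟨c.2, by simp [hνc]⟩
      have hEq : ν = ρ + Finsupp.single c 1 := by
        ext j
        by_contra hne
        have h1 := (hν2 j (Ne.symm hne)).trans hcls
        rcases h1.lt_or_eq with h2 | h2
        · apply hne
          have : c ≠ j := by rintro rfl; omega
          simp [F3 ν hνL j h2, hρ0 j h2, this]
        · have : j = c := Fin.ext h2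
          subst this
          apply hne
          simp [hνc]
      have h3 := hmax ν ⟨hνL, by omega⟩
      have h4 := degree_of_mem hth hρt
      rw [hEq, map_add, Finsupp.degree_single] at h3
      omega
    have h1 := nf_mem_varI F1 F2' F3 hXt hstd (by simp)
    have h2 : t' ∈ varI n K c := by
      rw [mem_varI] at h1 ⊢
      intro a ha
      obtain ⟨j, hj, hj'⟩ := h1 (Finsupp.single c 1 + a) (by
        rw [mem_support_iff, coeff_X_mul]; exact mem_support_iff.1 ha)
      refine ⟨j, hj, ?_⟩
      have : c ≠ j := by rintro rfl; omega
      simpa [Finsupp.single_apply, this] using hj'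
    have h3 : X k * s = (X k * s - t) + ((t - t') + t') := by ring
    rw [h3]
    exact add_mem (Ideal.mem_sup_left htI) (Ideal.mem_sup_right (add_mem htv h2))
end

/-- Thm. 2.4 (iii): for a Pommaret basis w.r.t. revlex with minimal class
`d` (0-based: the variables `x_1,…,x_{d-1}` are `X j` for `(j : ℕ) < d₀`), the sequence
`x_1,…,x_{d-1}` is `P/I`-regular and there is no homogeneous `P/I`-regular sequence in the
maximal ideal of length `d`. -/
theorem statement3 {n : ℕ} {K : Type*} [Field K] (m : MonomialOrder (Fin n))
    (hrev : IsRevLex m)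
    (I : Ideal (MvPolynomial (Fin n) K)) (hI0 : I ≠ ⊥) (hIT : I ≠ ⊤) (hIhom : IsHomIdeal I)
    (H : Finset (MvPolynomial (Fin n) K)) (hPB : IsPB m H I)
    (d0 : ℕ) (hd0 : IsLeast {c : ℕ | ∃ h ∈ H, cls (ldeg m h) = c} d0) :
    ((∀ i : Fin n, (i : ℕ) < d0 → ∀ f : MvPolynomial (Fin n) K,
        X i * f ∈ I ⊔ Ideal.span {p | ∃ j : Fin n, (j : ℕ) < (i : ℕ) ∧ p = X j} →
        f ∈ I ⊔ Ideal.span {p | ∃ j : Fin n, (j : ℕ) < (i : ℕ) ∧ p = X j}) ∧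
      I ⊔ Ideal.span {p | ∃ j : Fin n, (j : ℕ) < d0 ∧ p = X j} ≠ ⊤) ∧
    ¬ ∃ g : Fin (d0 + 1) → MvPolynomial (Fin n) K,
        (∀ i, (∃ k, (g i).IsHomogeneous k) ∧ g i ∈ mxI n K) ∧
        (∀ i : Fin (d0 + 1), ∀ f : MvPolynomial (Fin n) K,
          g i * f ∈ I ⊔ Ideal.span {p | ∃ j : Fin (d0 + 1), j < i ∧ p = g j} →
          f ∈ I ⊔ Ideal.span {p | ∃ j : Fin (d0 + 1), j < i ∧ p = g j}) ∧
        I ⊔ Ideal.span (Set.range g) ≠ ⊤ := by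
  classical
  obtain ⟨hH1, hH2, -, hfin, hlt, huniq⟩ := hPB
  obtain ⟨⟨h0, hh0, hh0'⟩, hmin⟩ := hd0
  set L : Set (Fin n →₀ ℕ) := (fun h : MvPolynomial (Fin n) K => ldeg m h) '' ↑H with hL
  have hdeg : ∀ f : MvPolynomial (Fin n) K, ldeg m f = m.degree f := fun f => rfl
  have hmem : ∀ ν : Fin n →₀ ℕ, monomial ν (1 : K) ∈ ltIdeal m I ↔ ∃ μ ∈ L, μ ≤ ν := by
    intro ν
    rw [hlt, mem_ideal_span_monomial_image]
    simp [support_monomial]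
  have F1 : ∀ f, ∃ r, IsStd L r ∧ f - r ∈ I := by
    intro f
    obtain ⟨g, r, h1, -, h3⟩ := m.div_set (B := (H : Set (MvPolynomial (Fin n) K)))
      (fun b hb => (m.leadingCoeff_ne_zero_iff.2 (hH2 b hb)).isUnit) f
    refine ⟨r, ?_, ?_⟩
    · rintro c hc μ ⟨h, hh, rfl⟩
      exact h3 c hc h hh
    · rw [h1, add_sub_cancel_right, Finsupp.linearCombination_apply]
      exact Submodule.sum_mem _ fun b _ => Ideal.mul_mem_left _ _ (hH1 b b.2)
  have F2 : ∀ r ∈ I, r ≠ 0 → ∃ μ ∈ L, μ ≤ m.degree r := by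
    intro r hr hr0
    rw [← hmem]
    exact Ideal.subset_span ⟨r, hr, hr0, rfl⟩
  have F2' : ∀ r ∈ I, IsStd L r → r = 0 := by
    intro r hr hs
    by_contra h0
    obtain ⟨μ, hμ, hle⟩ := F2 r hr h0
    exact hs _ (m.degree_mem_support h0) μ hμ hle
  have F3' : ∀ μ ∈ L, d0 ≤ cls μ := by
    rintro μ ⟨h, hh, rfl⟩
    exact hmin ⟨h, hh, rfl⟩
  have F3 : ∀ μ ∈ L, ∀ j : Fin n, (j : ℕ) < d0 → μ j = 0 := by
    intro μ hμ j hj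
    by_contra hne
    have : cls μ ≤ j := Nat.sInf_le ⟨j.2, hne⟩
    have := F3' μ hμ
    omega
  have F4 : ∀ ν, (∃ μ ∈ L, μ ≤ ν) → ∃! μ, μ ∈ L ∧ InvDiv μ ν :=
    fun ν hν => huniq ν ((hmem ν).2 hν)
  have hIm : I ≤ mxI n K ∧ mxI n K ≠ ⊤ := by
    have hker : mxI n K = RingHom.ker (constantCoeff (σ := Fin n) (R := K)) := by
      ext f
      rw [mxI, ← Set.image_univ, mem_ideal_span_X_image, RingHom.mem_ker, constantCoeff_eq]
      constructor
      · intro h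
        by_contra hne
        obtain ⟨i, -, hi⟩ := h 0 (mem_support_iff.2 hne)
        exact hi rfl
      · intro h c hc
        have hc0 : c ≠ 0 := by
          rintro rfl
          exact mem_support_iff.1 hc h
        obtain ⟨j, hj⟩ := Finsupp.ne_iff.1 hc0
        exact ⟨j, Set.mem_univ j, hj⟩
    constructor
    · intro f hf
      rw [hker, RingHom.mem_ker]
      by_contra hne
      apply hIT
      have h1 := homComp_mem hIhom hf 0
      rw [homogeneousComponent_zero] at h1
      exact Ideal.eq_top_of_isUnit_mem _ h1 ((IsUnit.mk0 _ hne).map C)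
    · rw [hker]
      exact RingHom.ker_ne_top _
  have hvm : ∀ i, varI n K i ≤ mxI n K := by
    intro i
    apply Ideal.span_mono
    rintro p ⟨j, -, rfl⟩
    exact ⟨j, rfl⟩
  have hL0 : ldeg m h0 ∈ L := ⟨h0, hh0, rfl⟩
  have hne0 : ldeg m h0 ≠ 0 := by
    intro h
    apply hIT
    rw [eq_top_iff]
    intro f _
    obtain ⟨r, hr, hr'⟩ := F1 f
    have : r = 0 := by
      by_contra hr0
      exact hr _ (m.degree_mem_support hr0) _ hL0 (by rw [h]; exact zero_le)
    rwa [this, sub_zero] at hr'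
  have hcls : ∃ hi : d0 < n, ldeg m h0 ⟨d0, hi⟩ ≠ 0 := by
    have hnon : {i : ℕ | ∃ hi : i < n, ldeg m h0 ⟨i, hi⟩ ≠ 0}.Nonempty := by
      obtain ⟨j, hj⟩ := Finsupp.ne_iff.1 hne0
      exact ⟨j, j.2, hj⟩
    have := Nat.sInf_mem hnon
    change cls _ ∈ _ at this
    rwa [hh0'] at this
  obtain ⟨hdn, hd⟩ := hcls
  have hreg := fun (i : Fin n) (hi : (i : ℕ) < d0) => regular_part F1 F2' F3 i hi
  refine ⟨⟨hreg, ?_⟩, ?_⟩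
  · intro h
    exact hIm.2 (top_le_iff.1 (h ▸ sup_le hIm.1 (hvm d0)))
  · rintro ⟨g, hg1, hg2, hg3⟩
    obtain ⟨s, hs, hs'⟩ := socle hfin hIhom m hrev F1 F2 ⟨d0, hdn⟩ F3 F3' ⟨_, hL0, hd⟩ F4
    let x : Fin d0 → MvPolynomial (Fin n) K := fun j => X ⟨j, j.2.trans hdn⟩
    have hx1 : ∀ i : Fin d0, Ideal.span {p | ∃ j : Fin d0, j < i ∧ p = x j} = varI n K i := by
      intro i
      unfold varI
      congr 1
      ext p
      constructor
      · rintro ⟨j, hj, rfl⟩; exact ⟨⟨j, j.2.trans hdn⟩, hj, rfl⟩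
      · rintro ⟨j, hj, rfl⟩; exact ⟨⟨j, hj.trans i.2⟩, hj, rfl⟩
    have hx2 : Ideal.span (Set.range x) = varI n K d0 := by
      unfold varI
      congr 1
      ext p
      constructor
      · rintro ⟨j, rfl⟩; exact ⟨⟨j, j.2.trans hdn⟩, j.2, rfl⟩
      · rintro ⟨j, hj, rfl⟩; exact ⟨⟨j, hj⟩, rfl⟩
    refine depth_contra I (mxI n K) hIm.1 hIm.2 x g ?_ hg2 (fun i => (hg1 i).2) hg3 s ?_ ?_
    · intro i
      rw [hx1]
      exact hreg ⟨i, i.2.trans hdn⟩ i.2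
    · rw [hx2]; exact hs
    · rw [hx2]
      intro a ha
      unfold mxI at ha
      induction ha using Submodule.span_induction with
      | mem y hy => obtain ⟨k, rfl⟩ := hy; exact hs' k
      | zero => simp
      | add y z _ _ h1 h2 => rw [add_mul]; exact add_mem h1 h2
      | smul b y _ h => rw [smul_eq_mul, mul_assoc]; exact Ideal.mul_mem_left _ _ h
end

section
/- Let H be a Pommaret basis of the proper nonzero homogeneous ideal I of P for some term order. Denote by β_0^(k) the number of generators h ∈ H with cls(lt(h)) = k and set d = min_{h∈H} cls(lt(h)). Then I possesses a finite free resolution 0 → P^{r_{n−d}} → ⋯ → P^{r_1} → P^{r_0} → I → 0 of length n−d, i.e., an exact sequence of P-modules with free modules of ranks r_i = Σ_{k=d}^{n−i} C(n−k, i)·β_0^(k), where C denotes the binomial coefficient. -/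
open MvPolynomial

namespace Pomm

universe u

/-- the `K`-subspace of vectors of polynomials all whose terms satisfy `D` -/
def Supp {n : ℕ} {K : Type u} [Field K] {A : Type u} (D : A → (Fin n →₀ ℕ) → Prop) :
    Submodule K (A → MvPolynomial (Fin n) K) where
  carrier := {f | ∀ a ν, coeff ν (f a) ≠ 0 → D a ν}
  add_mem' := by
    intro f g hf hg a ν h
    by_cases h1 : coeff ν (f a) = 0
    · refine hg a ν ?_
      intro h2
      apply h
      simp [h1, h2]
    · exact hf a ν h1
  zero_mem' := by intro a ν h; simp at h
  smul_mem' := by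
    intro c f hf a ν h
    refine hf a ν ?_
    intro h2
    apply h
    simp [h2]

theorem mem_Supp {n : ℕ} {K : Type u} [Field K] {A : Type u} {D : A → (Fin n →₀ ℕ) → Prop}
    {f : A → MvPolynomial (Fin n) K} :
    f ∈ Supp D ↔ ∀ a ν, coeff ν (f a) ≠ 0 → D a ν := Iff.rfl

theorem single_mem_Supp {n : ℕ} {K : Type u} [Field K] {A : Type u} [DecidableEq A]
    {D : A → (Fin n →₀ ℕ) → Prop} {a : A} {ν : Fin n →₀ ℕ} (c : K) (h : D a ν) :
    (Pi.single a (monomial ν c) : A → MvPolynomial (Fin n) K) ∈ Supp D := by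
  intro b μ hb
  by_cases hab : b = a
  · subst hab
    rw [Pi.single_eq_same, coeff_monomial] at hb
    split_ifs at hb with h1
    · exact h1 ▸ h
    · exact absurd rfl hb
  · rw [Pi.single_eq_of_ne hab] at hb
    simp at hb

theorem Supp_le {n : ℕ} {K : Type u} [Field K] {A : Type u} [Fintype A] [DecidableEq A]
    {D : A → (Fin n →₀ ℕ) → Prop} {W : Submodule K (A → MvPolynomial (Fin n) K)}
    (h : ∀ a ν, D a ν → (Pi.single a (monomial ν (1 : K)) : A → MvPolynomial (Fin n) K) ∈ W) :
    Supp D ≤ W := by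
  intro f hf
  have : f = ∑ a, ∑ ν ∈ (f a).support,
      (coeff ν (f a)) • (Pi.single a (monomial ν (1 : K)) : A → MvPolynomial (Fin n) K) := by
    have h1 : f = ∑ a, Pi.single a (f a) := (Finset.univ_sum_single f).symm
    conv_lhs => rw [h1]
    refine Finset.sum_congr rfl fun a _ => ?_
    have h2 : f a = ∑ ν ∈ (f a).support, monomial ν (coeff ν (f a)) := (f a).as_sum
    conv_lhs => rw [h2]
    funext b
    by_cases hb : b = a
    · subst hb
      simp only [Finset.sum_apply, Pi.smul_apply, Pi.single_eq_same, smul_monomial, smul_eq_mul,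
        mul_one]
    · simp [hb]
  rw [this]
  refine Submodule.sum_mem _ fun a _ => Submodule.sum_mem _ fun ν hν => ?_
  exact W.smul_mem _ (h a ν (hf a ν (mem_support_iff.mp hν)))

theorem Supp_mono {n : ℕ} {K : Type u} [Field K] {A : Type u} 
    {D D' : A → (Fin n →₀ ℕ) → Prop} (h : ∀ a ν, D a ν → D' a ν) :
    (Supp D : Submodule K (A → MvPolynomial (Fin n) K)) ≤ Supp D' :=
  fun _ hf a ν hc => h a ν (hf a ν hc)

/-- every nonempty set of terms of a vector has a maximal term -/
theorem exists_max_term {n : ℕ} {K : Type u} [Field K] {A : Type u} [Fintype A]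
    (f : A → MvPolynomial (Fin n) K) (hf : f ≠ 0)
    (R : (A × (Fin n →₀ ℕ)) → (A × (Fin n →₀ ℕ)) → Prop)
    (hirr : ∀ x, ¬ R x x) (htr : ∀ x y z, R x y → R y z → R x z) :
    ∃ a ν, coeff ν (f a) ≠ 0 ∧ ∀ b μ, coeff μ (f b) ≠ 0 → ¬ R (a, ν) (b, μ) := by
  classical
  let T : Set (A × (Fin n →₀ ℕ)) := {x | coeff x.2 (f x.1) ≠ 0}
  have hT : T.Finite := by
    have : T ⊆ ↑((Finset.univ : Finset A).biUnion fun a => ((f a).support.image fun ν => (a, ν))) := by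
      intro x hx
      simp only [Finset.coe_biUnion, Set.mem_iUnion]
      refine ⟨x.1, by simp, ?_⟩
      simp only [Finset.coe_image, Set.mem_image]
      exact ⟨x.2, mem_support_iff.mpr hx, rfl⟩
    exact (Finset.finite_toSet _).subset this
  have hne : ∃ x, x ∈ T := by
    by_contra hcon
    push Not at hcon
    apply hf
    funext a
    ext ν
    have := hcon (a, ν)
    simpa [T] using this
  have : Finite T := hT
  let R' : T → T → Prop := fun x y => R y.1 x.1
  have : IsTrans T R' := ⟨fun x y z h1 h2 => htr _ _ _ h2 h1⟩
  have : Std.Irrefl R' := ⟨fun x h => hirr _ h⟩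
  have wf : WellFounded R' := Finite.wellFounded_of_trans_of_irrefl R'
  obtain ⟨x0, hx0⟩ := hne
  obtain ⟨x, -, hx⟩ := wf.has_min Set.univ ⟨⟨x0, hx0⟩, trivial⟩
  exact ⟨x.1.1, x.1.2, x.2, fun b μ hb hR => hx ⟨(b, μ), hb⟩ trivial hR⟩

/-- A step of the resolution: generators `A` with classes `c`, an order on terms, and the
syzygy module `S` of the generators. -/
structure Stage (n : ℕ) (K : Type u) [Field K] where
  A : Type u
  fin : Fintype A
  dec : DecidableEq A
  c : A → Fin n
  lt : (A × (Fin n →₀ ℕ)) → (A × (Fin n →₀ ℕ)) → Prop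
  S : Submodule (MvPolynomial (Fin n) K) (A → MvPolynomial (Fin n) K)
  wf : WellFounded lt
  trans : ∀ x y z, lt x y → lt y z → lt x z
  transl : ∀ a b μ ν ρ, lt (a, μ) (b, ν) → lt (a, μ + ρ) (b, ν + ρ)
  indep : ∀ f ∈ S, (∀ a ν, coeff ν (f a) ≠ 0 → ∀ j ∈ ν.support, j ≤ c a) → f = 0
  red : ∀ a k, c a < k → ∃ p : A → MvPolynomial (Fin n) K,
    (∀ b ν, coeff ν (p b) ≠ 0 →
      (∀ j ∈ ν.support, j ≤ c b) ∧ lt (b, ν) (a, Finsupp.single k 1)) ∧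
    Pi.single a (X k) - p ∈ S

attribute [instance] Stage.fin Stage.dec

namespace Stage

variable {n : ℕ} {K : Type u} [Field K] (Y : Stage n K)

/-- index set of the syzygies -/
abbrev A' : Type u := {x : Y.A × Fin n // Y.c x.1 < x.2}

noncomputable def p (x : Y.A') : Y.A → MvPolynomial (Fin n) K :=
  Classical.choose (Y.red x.1.1 x.1.2 x.2)

theorem p_spec (x : Y.A') : ∀ b ν, coeff ν (Y.p x b) ≠ 0 →
      (∀ j ∈ ν.support, j ≤ Y.c b) ∧ Y.lt (b, ν) (x.1.1, Finsupp.single x.1.2 1) :=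
  (Classical.choose_spec (Y.red x.1.1 x.1.2 x.2)).1

noncomputable def h (x : Y.A') : Y.A → MvPolynomial (Fin n) K :=
  Pi.single x.1.1 (X x.1.2) - Y.p x

theorem h_mem (x : Y.A') : Y.h x ∈ Y.S :=
  (Classical.choose_spec (Y.red x.1.1 x.1.2 x.2)).2

/-- the differential -/
noncomputable def d : (Y.A' → MvPolynomial (Fin n) K) →ₗ[MvPolynomial (Fin n) K]
    (Y.A → MvPolynomial (Fin n) K) :=
  Fintype.linearCombination (MvPolynomial (Fin n) K) Y.h

theorem d_apply (f : Y.A' → MvPolynomial (Fin n) K) : Y.d f = ∑ x, f x • Y.h x :=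
  Fintype.linearCombination_apply _ _ _

theorem d_single (x : Y.A') (q : MvPolynomial (Fin n) K) : Y.d (Pi.single x q) = q • Y.h x :=
  Fintype.linearCombination_apply_single _ _ _ _

theorem d_mem (f : Y.A' → MvPolynomial (Fin n) K) : Y.d f ∈ Y.S := by
  rw [d_apply]
  exact Submodule.sum_mem _ fun x _ => Y.S.smul_mem _ (Y.h_mem x)

theorem irr (x) : ¬ Y.lt x x := fun hx => Y.wf.asymmetric _ _ hx hx

/-- multiplicative terms -/
def M (a : Y.A) (ν : Fin n →₀ ℕ) : Prop := ∀ j ∈ ν.support, j ≤ Y.c a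

def M' (x : Y.A') (ν : Fin n →₀ ℕ) : Prop := ∀ j ∈ ν.support, j ≤ x.1.2

theorem eq_of_max {k l : Fin n} {μ ν : Fin n →₀ ℕ} (hμ : ∀ j ∈ μ.support, j ≤ k)
    (hν : ∀ j ∈ ν.support, j ≤ l) (h : μ + Finsupp.single k 1 = ν + Finsupp.single l 1) :
    k = l := by
  have key : ∀ {k l : Fin n} {μ ν : Fin n →₀ ℕ}, (∀ j ∈ ν.support, j ≤ l) →
      (μ + Finsupp.single k 1 = ν + Finsupp.single l 1) → k ≤ l := by
    intro k l μ ν hν h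
    by_cases hkl : l = k
    · exact hkl.ge
    · refine hν k ?_
      have := DFunLike.congr_fun h k
      simp [hkl] at this
      simp
      omega
  exact le_antisymm (key hν h) (key hμ h.symm)

theorem mul_p_mem (x : Y.A') (ν : Fin n →₀ ℕ) :
    (monomial ν (1 : K)) • Y.p x ∈ (Supp (fun b μ =>
      Y.lt (b, μ) (x.1.1, ν + Finsupp.single x.1.2 1)) : Submodule K _) := by
  intro b μ hb
  rw [Pi.smul_apply, smul_eq_mul, coeff_monomial_mul'] at hb
  split_ifs at hb with hle
  · rw [one_mul] at hb
    have := Y.transl _ _ _ _ ν (Y.p_spec x b _ hb).2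
    rwa [tsub_add_cancel_of_le hle, add_comm _ ν] at this
  · exact absurd rfl hb

theorem d_inj (f : Y.A' → MvPolynomial (Fin n) K) (hf : f ∈ (Supp Y.M' : Submodule K _))
    (h0 : Y.d f = 0) : f = 0 := by
  by_contra hne
  obtain ⟨x, μ, hx, hmax⟩ := exists_max_term f hne
    (fun s t => Y.lt (s.1.1.1, s.2 + Finsupp.single s.1.1.2 1)
      (t.1.1.1, t.2 + Finsupp.single t.1.1.2 1)) (fun s => Y.irr _)
    (fun s t v h1 h2 => Y.trans _ _ _ h1 h2)
  have h1 := congrArg (coeff (μ + Finsupp.single x.1.2 1)) (congrFun h0 x.1.1)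
  rw [d_apply, Finset.sum_apply, Pi.zero_apply, coeff_zero, coeff_sum,
    Finset.sum_eq_single x] at h1
  · rw [h, Pi.smul_apply, Pi.sub_apply, Pi.single_eq_same, smul_eq_mul, mul_sub, coeff_sub,
      coeff_mul_X] at h1
    rw [coeff_mul, Finset.sum_eq_zero, sub_zero] at h1
    · exact hx h1
    · intro q hq
      by_contra hcon
      have hq1 := left_ne_zero_of_mul hcon
      have hq2 := right_ne_zero_of_mul hcon
      refine hmax _ _ hq1 ?_
      have := Y.transl _ _ _ _ q.1 (Y.p_spec x _ _ hq2).2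
      rwa [add_comm, Finset.HasAntidiagonal.mem_antidiagonal.mp hq, add_comm _ q.1] at this
  · intro y _ hyx
    rw [h, Pi.smul_apply, Pi.sub_apply, smul_eq_mul, mul_sub, coeff_sub]
    have e2 : coeff (μ + Finsupp.single x.1.2 1) (f y * Y.p y x.1.1) = 0 := by
      rw [coeff_mul]
      refine Finset.sum_eq_zero fun q hq => ?_
      by_contra hcon
      have hq1 := left_ne_zero_of_mul hcon
      have hq2 := right_ne_zero_of_mul hcon
      refine hmax _ _ hq1 ?_
      have := Y.transl _ _ _ _ q.1 (Y.p_spec y _ _ hq2).2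
      rwa [add_comm, Finset.HasAntidiagonal.mem_antidiagonal.mp hq, add_comm _ q.1] at this
    rw [e2, sub_zero]
    by_contra hcon
    by_cases hax : x.1.1 = y.1.1
    · rw [hax, Pi.single_eq_same, coeff_mul_X'] at hcon
      split_ifs at hcon with hs
      · have h2 := hf _ _ hcon
        have hle : Finsupp.single y.1.2 1 ≤ μ + Finsupp.single x.1.2 1 := by
          rw [Finsupp.single_le_iff]
          rw [Finsupp.mem_support_iff] at hs
          omega
        have := eq_of_max (hf _ _ hx) h2 (tsub_add_cancel_of_le hle).symm
        exact hyx (Subtype.ext (Prod.ext hax.symm this.symm))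
      · exact hcon rfl
    · rw [Pi.single_eq_of_ne hax] at hcon
      simp at hcon
  · simp

theorem decomp (D : (Y.A × (Fin n →₀ ℕ)) → Prop) (hD : ∀ s t, Y.lt s t → D t → D s) :
    (Supp (fun a ν => D (a, ν)) : Submodule K (Y.A → MvPolynomial (Fin n) K)) ≤
      Supp Y.M ⊔ (Supp (fun (x : Y.A') μ => Y.M' x μ ∧
        D (x.1.1, μ + Finsupp.single x.1.2 1))).map (Y.d.restrictScalars K) := by
  have key : ∀ t, D t → (Pi.single t.1 (monomial t.2 (1 : K)) : Y.A → MvPolynomial (Fin n) K) ∈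
      Supp Y.M ⊔ (Supp (fun (x : Y.A') μ => Y.M' x μ ∧
        D (x.1.1, μ + Finsupp.single x.1.2 1))).map (Y.d.restrictScalars K) := by
    intro t
    induction t using Y.wf.induction with
    | _ t ih =>
    intro ht
    by_cases hM : Y.M t.1 t.2
    · exact Submodule.mem_sup_left (single_mem_Supp _ hM)
    · obtain ⟨a, ν⟩ := t
      simp only [M] at hM
      push Not at hM
      obtain ⟨j, hj, hcj⟩ := hM
      have hne : ν.support.Nonempty := ⟨j, hj⟩
      obtain ⟨k, hk, hkmax⟩ := ν.support.exists_max_image id hne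
      simp only [id] at hkmax
      have hle : Finsupp.single k 1 ≤ ν := by
        rw [Finsupp.single_le_iff]
        rw [Finsupp.mem_support_iff] at hk
        omega
      let x : Y.A' := ⟨(a, k), lt_of_lt_of_le hcj (hkmax j hj)⟩
      have hν : (ν - Finsupp.single k 1) + Finsupp.single k 1 = ν := tsub_add_cancel_of_le hle
      set μ := ν - Finsupp.single k 1 with hμ
      have e : (Pi.single a (monomial ν (1 : K)) : Y.A → MvPolynomial (Fin n) K) =
          Y.d (Pi.single x (monomial μ 1)) + (monomial μ (1 : K)) • Y.p x := by
        rw [d_single, h, smul_sub, sub_add_cancel]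
        change _ = monomial μ (1 : K) • (Pi.single a (X k) : Y.A → MvPolynomial (Fin n) K)
        rw [← Pi.single_smul, smul_eq_mul, X, monomial_mul, hν, one_mul]
      rw [e]
      refine add_mem (Submodule.mem_sup_right ?_) ?_
      · refine Submodule.mem_map.mpr ⟨Pi.single x (monomial μ 1), single_mem_Supp _ ⟨?_, ?_⟩, rfl⟩
        · intro i hi
          refine hkmax i ?_
          rw [← hν, Finsupp.mem_support_iff, Finsupp.add_apply]
          rw [Finsupp.mem_support_iff] at hi
          omega
        · change D (a, μ + Finsupp.single k 1)
          rw [hν]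
          exact ht
      · refine Supp_le ?_ (Y.mul_p_mem x μ)
        intro b ρ hb
        have hb' : Y.lt (b, ρ) (a, ν) := by
          rw [← hν]
          exact hb
        exact ih _ hb' (hD _ _ hb' ht)
  exact Supp_le fun a ν h => key (a, ν) h

theorem decomp_S (D : (Y.A × (Fin n →₀ ℕ)) → Prop) (hD : ∀ s t, Y.lt s t → D t → D s)
    (f : Y.A → MvPolynomial (Fin n) K) (hf : ∀ a ν, coeff ν (f a) ≠ 0 → D (a, ν))
    (hS : f ∈ Y.S) : ∃ g : Y.A' → MvPolynomial (Fin n) K, Y.d g = f ∧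
      ∀ x μ, coeff μ (g x) ≠ 0 → Y.M' x μ ∧ D (x.1.1, μ + Finsupp.single x.1.2 1) := by
  obtain ⟨u, hu, v, hv, huv⟩ := Submodule.mem_sup.mp (Y.decomp D hD hf)
  obtain ⟨g, hg, rfl⟩ := Submodule.mem_map.mp hv
  refine ⟨g, ?_, hg⟩
  change u + Y.d g = f at huv
  have : u ∈ Y.S := by
    have : u = f - Y.d g := by rw [← huv]; simp
    rw [this]
    exact sub_mem hS (Y.d_mem g)
  rw [Y.indep u this hu, zero_add] at huv
  exact huv

theorem range_d : LinearMap.range Y.d = Y.S := by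
  apply le_antisymm
  · rintro _ ⟨g, rfl⟩
    exact Y.d_mem g
  · intro f hf
    obtain ⟨g, hg, -⟩ := Y.decomp_S (fun _ => True) (fun _ _ _ _ => trivial) f
      (fun _ _ _ => trivial) hf
    exact ⟨g, hg⟩

def lt' (s t : Y.A' × (Fin n →₀ ℕ)) : Prop :=
  Prod.Lex Y.lt (fun k l : Fin n => l < k)
    ((s.1.1.1, s.2 + Finsupp.single s.1.1.2 1), s.1.1.2)
    ((t.1.1.1, t.2 + Finsupp.single t.1.1.2 1), t.1.1.2)

noncomputable def next : Stage n K where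
  A := Y.A'
  fin := by classical infer_instance
  dec := by classical infer_instance
  c := fun x => x.1.2
  lt := Y.lt'
  S := LinearMap.ker Y.d
  wf := by
    refine InvImage.wf (r := Prod.Lex Y.lt (fun k l : Fin n => l < k))
      (fun s : Y.A' × (Fin n →₀ ℕ) =>
        ((s.1.1.1, s.2 + Finsupp.single s.1.1.2 1), s.1.1.2)) ?_
    exact Y.wf.prod_lex wellFounded_gt
  trans := by
    intro x y z h1 h2
    simp only [lt', Prod.lex_def] at *
    rcases h1 with h1 | ⟨h1, h1'⟩ <;> rcases h2 with h2 | ⟨h2, h2'⟩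
    · exact Or.inl (Y.trans _ _ _ h1 h2)
    · exact Or.inl (h2 ▸ h1)
    · exact Or.inl (h1 ▸ h2)
    · exact Or.inr ⟨h1.trans h2, h2'.trans h1'⟩
  transl := by
    intro a b μ ν ρ h
    simp only [lt', Prod.lex_def] at *
    rcases h with h | ⟨h, h'⟩
    · left
      have := Y.transl _ _ _ _ ρ h
      rwa [add_right_comm μ, add_right_comm ν]
    · right
      refine ⟨?_, h'⟩
      rw [Prod.mk.injEq] at h ⊢
      refine ⟨h.1, ?_⟩
      rw [add_right_comm μ, add_right_comm ν, h.2]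
  indep := fun f hf hM => Y.d_inj f hM hf
  red := by
    classical
    intro x j hj
    obtain ⟨g, hg, hgM⟩ := Y.decomp_S
      (fun t => t = (x.1.1, Finsupp.single j 1 + Finsupp.single x.1.2 1) ∨
        Y.lt t (x.1.1, Finsupp.single j 1 + Finsupp.single x.1.2 1))
      (fun s t hst ht => by
        rcases ht with rfl | ht
        · exact Or.inr hst
        · exact Or.inr (Y.trans _ _ _ hst ht))
      ((X j : MvPolynomial (Fin n) K) • Y.h x)
      (by
        intro a ν hc
        rw [h, smul_sub] at hc
        by_cases h2 : coeff ν (((X j : MvPolynomial (Fin n) K) • Y.p x) a) = 0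
        · left
          rw [Pi.sub_apply, coeff_sub, h2, sub_zero, ← Pi.single_smul, smul_eq_mul, X, X,
            monomial_mul, one_mul] at hc
          exact single_mem_Supp (D := fun a ν => (a, ν) =
            (x.1.1, Finsupp.single j 1 + Finsupp.single x.1.2 1)) _ rfl a ν hc
        · right
          exact Y.mul_p_mem x (Finsupp.single j 1) a ν h2)
      (Y.S.smul_mem _ (Y.h_mem x))
    refine ⟨g, ?_, ?_⟩
    · intro y ν hy
      obtain ⟨h1, h2⟩ := hgM y ν hy
      refine ⟨h1, ?_⟩
      simp only [lt', Prod.lex_def]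
      rcases h2 with h2 | h2
      · right
        refine ⟨h2, ?_⟩
        rw [Prod.mk.injEq] at h2
        have h3 := h2.2
        rw [add_comm (Finsupp.single j 1)] at h3
        have : y.1.2 = j := by
          refine eq_of_max h1 ?_ h3
          intro i hi
          rw [Finsupp.mem_support_iff, Finsupp.single_apply_ne_zero] at hi
          exact hi.1 ▸ hj.le
        rw [this]
        exact hj
      · exact Or.inl h2
    · rw [LinearMap.mem_ker, map_sub, hg, sub_eq_zero]
      have := Y.d_single x (X j)
      convert this

theorem sum_next (i : ℕ) :
    ∑ x : Y.next.A, Nat.choose (n - 1 - (Y.next.c x : ℕ)) i =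
      ∑ a : Y.A, Nat.choose (n - 1 - (Y.c a : ℕ)) (i + 1) := by
  classical
  have hs : ∀ N : ℕ, ∑ k ∈ Finset.range N, Nat.choose k i = Nat.choose N (i + 1) := by
    intro N
    induction N with
    | zero => simp
    | succ N ih => rw [Finset.sum_range_succ, ih, Nat.choose_succ_succ', add_comm]
  have hockey : ∀ c : Fin n, ∑ k ∈ Finset.univ.filter (fun k : Fin n => c < k),
      Nat.choose (n - 1 - (k : ℕ)) i = Nat.choose (n - 1 - (c : ℕ)) (i + 1) := by
    intro c
    rw [← hs]
    refine Finset.sum_nbij (fun k : Fin n => n - 1 - (k : ℕ)) ?_ ?_ ?_ ?_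
    · intro k hk
      simp only [Finset.mem_filter, Finset.mem_univ, true_and, Fin.lt_def] at hk
      simp only [Finset.mem_range]
      have := k.2
      omega
    · intro k _ l _ hkl
      have := k.2
      have := l.2
      simp only at hkl
      exact Fin.ext (by omega)
    · intro k hk
      simp only [Finset.coe_range, Set.mem_Iio] at hk
      refine ⟨⟨n - 1 - k, by omega⟩, ?_, ?_⟩
      · simp only [Finset.coe_filter, Finset.mem_univ, true_and, Set.mem_ofPred_eq, Fin.lt_def]
        omega
      · simp only
        omega
    · intro k _
      rfl
  rw [← Finset.sum_congr rfl fun a _ => hockey (Y.c a)]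
  have e1 : ∑ x : Y.next.A, Nat.choose (n - 1 - (Y.next.c x : ℕ)) i =
      ∑ x : Y.A', Nat.choose (n - 1 - (x.1.2 : ℕ)) i :=
    Fintype.sum_equiv (Equiv.refl _) _ _ fun _ => rfl
  rw [e1, Finset.sum_sigma']
  refine Finset.sum_bij (fun x _ => ⟨x.1.1, x.1.2⟩) ?_ ?_ ?_ ?_
  · intro x _
    simpa using x.2
  · intro x _ y _ hxy
    simp only [Sigma.mk.injEq, heq_eq_eq] at hxy
    exact Subtype.ext (Prod.ext hxy.1 hxy.2)
  · rintro ⟨a, k⟩ hk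
    exact ⟨⟨(a, k), by simpa using hk⟩, Finset.mem_univ _, rfl⟩
  · intro x _
    rfl

/-- the iterated stages -/
noncomputable def iter (Y : Stage n K) : ℕ → Stage n K
  | 0 => Y
  | i + 1 => (iter Y i).next

theorem card_iter (i : ℕ) : ∀ j, ∑ x : (Y.iter i).A, Nat.choose (n - 1 - ((Y.iter i).c x : ℕ)) j =
      ∑ a : Y.A, Nat.choose (n - 1 - (Y.c a : ℕ)) (i + j) := by
  induction i with
  | zero => intro j; rw [zero_add]; rfl
  | succ i ih =>
    intro j
    have := (Y.iter i).sum_next j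
    rw [ih] at this
    rw [show i + 1 + j = i + (j + 1) by ring, ← this]
    rfl

theorem card_iter' (i : ℕ) : Fintype.card (Y.iter i).A =
      ∑ a : Y.A, Nat.choose (n - 1 - (Y.c a : ℕ)) i := by
  have := Y.card_iter i 0
  simpa using this

/-- the differentials -/
noncomputable def dd (i : ℕ) : ((Y.iter (i + 1)).A → MvPolynomial (Fin n) K)
    →ₗ[MvPolynomial (Fin n) K] ((Y.iter i).A → MvPolynomial (Fin n) K) := (Y.iter i).d

theorem exact_dd (i : ℕ) : Function.Exact (Y.dd (i + 1)) (Y.dd i) := by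
  intro x
  have h : x ∈ LinearMap.range (Y.iter (i + 1)).d ↔ x ∈ (Y.iter (i + 1)).S := by
    rw [range_d]
  exact h.symm

theorem exact_conj {R M1 M2 M3 N1 N2 : Type*} [CommRing R] [AddCommGroup M1] [AddCommGroup M2]
    [AddCommGroup M3] [AddCommGroup N1] [AddCommGroup N2] [Module R M1]
    [Module R M2] [Module R M3] [Module R N1] [Module R N2]
    (e1 : N1 ≃ₗ[R] M1) (e2 : N2 ≃ₗ[R] M2) (f : M1 →ₗ[R] M2)
    (g : M2 →ₗ[R] M3) (h : Function.Exact f g) :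
    Function.Exact (e2.symm.toLinearMap ∘ₗ f ∘ₗ e1.toLinearMap) (g ∘ₗ e2.toLinearMap) := by
  intro x
  refine (h (e2 x)).trans ?_
  constructor
  · rintro ⟨y, hy⟩
    exact ⟨e1.symm y, by simp [hy]⟩
  · rintro ⟨y, rfl⟩
    exact ⟨e1 y, by simp⟩

theorem exact_post {R M1 M2 M3 N3 : Type*} [CommRing R] [AddCommGroup M1] [AddCommGroup M2]
    [AddCommGroup M3] [AddCommGroup N3] [Module R M1]
    [Module R M2] [Module R M3] [Module R N3]
    (e3 : M3 ≃ₗ[R] N3) (f : M1 →ₗ[R] M2)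
    (g : M2 →ₗ[R] M3) (h : Function.Exact f g) :
    Function.Exact f (e3.toLinearMap ∘ₗ g) := by
  intro x
  refine Iff.trans ?_ (h x)
  simp

/-- The resolution induced by a stage, in coordinates -/
theorem resolution {N : Type u} [AddCommGroup N] [Module (MvPolynomial (Fin n) K) N]
    (φ : ((Y.iter 0).A → MvPolynomial (Fin n) K) →ₗ[MvPolynomial (Fin n) K] N)
    (hφ : Function.Exact (Y.dd 0) φ) (r : ℕ → ℕ)
    (hr : ∀ i, r i = ∑ a : Y.A, Nat.choose (n - 1 - (Y.c a : ℕ)) i) :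
    ∃ (g : ∀ i : ℕ, ((Fin (r (i + 1)) → MvPolynomial (Fin n) K) →ₗ[MvPolynomial (Fin n) K]
          (Fin (r i) → MvPolynomial (Fin n) K)))
      (ε : (Fin (r 0) → MvPolynomial (Fin n) K) →ₗ[MvPolynomial (Fin n) K] N),
      LinearMap.range ε = LinearMap.range φ ∧
      Function.Exact (g 0) ε ∧
      ∀ i : ℕ, Function.Exact (g (i + 1)) (g i) := by
  have e : ∀ i, Nonempty (Fin (r i) ≃ (Y.iter i).A) := fun i =>
    ⟨((Fintype.equivFinOfCardEq ((Y.card_iter' i).trans (hr i).symm))).symm⟩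
  let E : ∀ i, (Fin (r i) → MvPolynomial (Fin n) K) ≃ₗ[MvPolynomial (Fin n) K]
      ((Y.iter i).A → MvPolynomial (Fin n) K) := fun i =>
    LinearEquiv.funCongrLeft _ _ (e i).some.symm
  refine ⟨fun i => (E i).symm.toLinearMap ∘ₗ Y.dd i ∘ₗ (E (i + 1)).toLinearMap,
    φ ∘ₗ (E 0).toLinearMap, ?_, ?_, ?_⟩
  · rw [LinearMap.range_comp, LinearEquiv.range, Submodule.map_top]
  · exact exact_conj (E 1) (E 0) _ _ hφ
  · intro i
    exact exact_post _ _ _ (exact_conj (E (i + 2)) (E (i + 1)) _ _ (Y.exact_dd i))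

end Stage

end Pomm

namespace Pomm

universe u

theorem cls_spec {n : ℕ} {μ : Fin n →₀ ℕ} (hμ : μ ≠ 0) :
    ∃ hi : cls μ < n, μ ⟨cls μ, hi⟩ ≠ 0 := by
  have hne : {i : ℕ | ∃ hi : i < n, μ ⟨i, hi⟩ ≠ 0}.Nonempty := by
    obtain ⟨j, hj⟩ := Finsupp.ne_iff.mp hμ
    exact ⟨j, j.2, hj⟩
  exact Nat.sInf_mem hne

theorem cls_le {n : ℕ} {μ : Fin n →₀ ℕ} (j : Fin n) (hj : μ j ≠ 0) : cls μ ≤ j :=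
  Nat.sInf_le ⟨j.2, hj⟩

section

variable {n : ℕ} {K : Type u} [Field K] (m : MonomialOrder (Fin n))
    (I : Ideal (MvPolynomial (Fin n) K))
    (H : Finset (MvPolynomial (Fin n) K))

theorem degree_ne_zero (hIT : I ≠ ⊤) (h1 : ∀ h ∈ H, h ∈ I) (h2 : ∀ h ∈ H, h ≠ 0) :
    ∀ h ∈ H, m.degree h ≠ 0 := by
  intro h hh h0
  apply hIT
  have e := m.eq_C_of_degree_eq_zero h0
  refine Ideal.eq_top_of_isUnit_mem I (h1 h hh) ?_
  rw [e]
  refine IsUnit.map C (IsUnit.mk0 _ ?_)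
  exact m.leadingCoeff_ne_zero_iff.mpr (h2 h hh)

theorem decomp0 (hPB : IsPB m H I) : ∀ f ∈ I, ∃ p : H → MvPolynomial (Fin n) K,
    ∑ h, p h • (h : MvPolynomial (Fin n) K) = f ∧ ∀ h ν, coeff ν (p h) ≠ 0 →
      (∀ j ∈ ν.support, (j : ℕ) ≤ cls (m.degree (h : MvPolynomial (Fin n) K))) ∧
      m.toSyn (ν + m.degree (h : MvPolynomial (Fin n) K)) ≤ m.toSyn (m.degree f) := by
  classical
  obtain ⟨h1, h2, h3, -, -, h4⟩ := hPB
  have key : ∀ s : m.syn, ∀ f ∈ I, m.toSyn (m.degree f) = s →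
      ∃ p : H → MvPolynomial (Fin n) K,
    ∑ h, p h • (h : MvPolynomial (Fin n) K) = f ∧ ∀ h ν, coeff ν (p h) ≠ 0 →
      (∀ j ∈ ν.support, (j : ℕ) ≤ cls (m.degree (h : MvPolynomial (Fin n) K))) ∧
      m.toSyn (ν + m.degree (h : MvPolynomial (Fin n) K)) ≤ m.toSyn (m.degree f) := by
    intro s
    induction s using WellFoundedLT.induction with
    | _ s ih =>
    intro f hf hs
    by_cases hf0 : f = 0
    · refine ⟨0, by simp [hf0], ?_⟩
      intro h ν hc
      simp at hc
    · obtain ⟨_, ⟨⟨h, hh, rfl⟩, hdiv⟩, -⟩ := h4 (m.degree f)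
        (Ideal.subset_span ⟨f, hf, hf0, rfl⟩)
      change InvDiv (m.degree h) (m.degree f) at hdiv
      obtain ⟨hle, hmul⟩ := hdiv
      set μ := m.degree f - m.degree h with hμ
      have hμh : μ + m.degree h = m.degree f := tsub_add_cancel_of_le hle
      have hμM : ∀ j ∈ μ.support, (j : ℕ) ≤ cls (m.degree h) := by
        intro j hj
        refine hmul j ?_
        rw [Finsupp.mem_support_iff] at hj
        intro e
        apply hj
        rw [hμ, Finsupp.tsub_apply, e, tsub_self]
      set c := m.leadingCoeff f / m.leadingCoeff h with hc
      have hch : m.leadingCoeff h ≠ 0 := m.leadingCoeff_ne_zero_iff.mpr (h2 h hh)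
      set q := monomial μ c with hq
      set f' := f - q * h with hf'
      have hf'I : f' ∈ I := sub_mem hf (I.mul_mem_left _ (h1 h hh))
      have hqh : ∀ ν, coeff ν (q * h) ≠ 0 → m.toSyn ν ≤ m.toSyn (m.degree f) := by
        intro ν hν
        rw [hq, coeff_monomial_mul'] at hν
        split_ifs at hν with hl
        · have := m.le_degree (mem_support_iff.mpr (right_ne_zero_of_mul hν))
          have h5 : m.toSyn ν = m.toSyn μ + m.toSyn (ν - μ) := by
            rw [← map_add, add_tsub_cancel_of_le hl]
          rw [h5, ← hμh, map_add]
          gcongr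
        · exact absurd rfl hν
      have hcoef : coeff (m.degree f) f' = 0 := by
        rw [hf', coeff_sub, ← hμh, hq, coeff_monomial_mul, hμh, hc]
        change m.leadingCoeff f - m.leadingCoeff f / m.leadingCoeff h * m.leadingCoeff h = 0
        rw [div_mul_cancel₀ _ hch, sub_self]
      have hle' : ∀ ν, coeff ν f' ≠ 0 → m.toSyn ν ≤ m.toSyn (m.degree f) := by
        intro ν hν
        by_cases h5 : coeff ν (q * h) = 0
        · rw [hf', coeff_sub, h5, sub_zero] at hν
          exact m.le_degree (mem_support_iff.mpr hν)
        · exact hqh ν h5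
      have hrec : ∃ p : H → MvPolynomial (Fin n) K,
          ∑ h, p h • (h : MvPolynomial (Fin n) K) = f' ∧ ∀ h ν, coeff ν (p h) ≠ 0 →
          (∀ j ∈ ν.support, (j : ℕ) ≤ cls (m.degree (h : MvPolynomial (Fin n) K))) ∧
          m.toSyn (ν + m.degree (h : MvPolynomial (Fin n) K)) ≤ m.toSyn (m.degree f) := by
        by_cases hf'0 : f' = 0
        · refine ⟨0, by simp [hf'0], ?_⟩
          intro h ν hc
          simp at hc
        · have hd : m.toSyn (m.degree f') < m.toSyn (m.degree f) := by
            have h5 : coeff (m.degree f') f' ≠ 0 := m.coeff_degree_ne_zero_iff.mpr hf'0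
            refine lt_of_le_of_ne (hle' _ h5) ?_
            intro e
            rw [m.toSyn.injective e] at h5
            exact h5 hcoef
          obtain ⟨p, hp, hp'⟩ := ih _ (hs ▸ hd) f' hf'I rfl
          exact ⟨p, hp, fun h ν hν => ⟨(hp' h ν hν).1, (hp' h ν hν).2.trans hd.le⟩⟩
      obtain ⟨p, hp, hp'⟩ := hrec
      refine ⟨p + Pi.single ⟨h, hh⟩ q, ?_, ?_⟩
      · simp only [Pi.add_apply, add_smul, Finset.sum_add_distrib, hp]
        rw [Finset.sum_eq_single (⟨h, hh⟩ : H)]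
        · rw [Pi.single_eq_same, hf', smul_eq_mul, sub_add_cancel]
        · intro b _ hb
          rw [Pi.single_eq_of_ne hb, zero_smul]
        · simp
      · exact add_mem (S := Submodule K (H → MvPolynomial (Fin n) K))
          (s := Supp (fun (h : H) ν =>
          (∀ j ∈ ν.support, (j : ℕ) ≤ cls (m.degree (h : MvPolynomial (Fin n) K))) ∧
          m.toSyn (ν + m.degree (h : MvPolynomial (Fin n) K)) ≤ m.toSyn (m.degree f)))
          hp' (single_mem_Supp c ⟨hμM, by rw [hμh]⟩)
  exact fun f hf => key _ f hf rfl

theorem indep0 (hPB : IsPB m H I) (f : H → MvPolynomial (Fin n) K)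
    (hf0 : ∑ h, f h • (h : MvPolynomial (Fin n) K) = 0)
    (hf : ∀ h ν, coeff ν (f h) ≠ 0 →
      (∀ j ∈ ν.support, (j : ℕ) ≤ cls (m.degree (h : MvPolynomial (Fin n) K)))) : f = 0 := by
  classical
  obtain ⟨h1, h2, h3, -, -, h4⟩ := hPB
  by_contra hne
  obtain ⟨a, ν, ha, hmax⟩ := exists_max_term f hne
    (fun s t => m.toSyn (s.2 + m.degree (s.1 : MvPolynomial (Fin n) K)) <
      m.toSyn (t.2 + m.degree (t.1 : MvPolynomial (Fin n) K)))
    (fun s => lt_irrefl _) (fun s t v => lt_trans)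
  simp only [not_lt] at hmax
  have hdiv : ∀ (b : H) μ, coeff μ (f b) ≠ 0 → InvDiv (m.degree (b : MvPolynomial (Fin n) K))
      (μ + m.degree (b : MvPolynomial (Fin n) K)) := by
    intro b μ hb
    refine ⟨le_add_of_nonneg_left zero_le, ?_⟩
    intro j hj
    refine hf b μ hb j ?_
    rw [Finsupp.mem_support_iff]
    intro h0
    exact hj (by rw [Finsupp.add_apply, h0, zero_add])
  have hbound : ∀ (b : H) (μ ρ : Fin n →₀ ℕ), coeff μ (f b) ≠ 0 →
      coeff ρ (b : MvPolynomial (Fin n) K) ≠ 0 →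
      μ + ρ = ν + m.degree (a : MvPolynomial (Fin n) K) →
      ρ = m.degree (b : MvPolynomial (Fin n) K) ∧
        μ + m.degree (b : MvPolynomial (Fin n) K) = ν + m.degree (a : MvPolynomial (Fin n) K) := by
    intro b μ ρ hμ hρ e
    have e1 := m.le_degree (mem_support_iff.mpr hρ)
    have e2 := hmax b μ hμ
    rw [← e, map_add, map_add] at e2
    have e3 : m.toSyn (m.degree (b : MvPolynomial (Fin n) K)) ≤ m.toSyn ρ := by
      exact le_of_add_le_add_left e2
    have e4 := m.toSyn.injective (le_antisymm e1 e3)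
    exact ⟨e4, e4 ▸ e⟩
  have hab : ∀ b μ ρ, coeff μ (f b) ≠ 0 → coeff ρ (b : MvPolynomial (Fin n) K) ≠ 0 →
      μ + ρ = ν + m.degree (a : MvPolynomial (Fin n) K) → b = a := by
    intro b μ ρ hμ hρ e
    obtain ⟨-, e2⟩ := hbound b μ ρ hμ hρ e
    have hmem : monomial (ν + m.degree (a : MvPolynomial (Fin n) K)) (1 : K) ∈ ltIdeal m I := by
      have : monomial (ν + m.degree (a : MvPolynomial (Fin n) K)) (1 : K) =
          monomial ν 1 * monomial (m.degree (a : MvPolynomial (Fin n) K)) 1 := by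
        rw [monomial_mul, one_mul]
      rw [this]
      exact Ideal.mul_mem_left _ _ (Ideal.subset_span ⟨a, h1 a a.2, h2 a a.2, rfl⟩)
    obtain ⟨w, -, hw⟩ := h4 _ hmem
    have w1 := hw (m.degree (a : MvPolynomial (Fin n) K)) ⟨⟨a, a.2, rfl⟩, hdiv a ν ha⟩
    have w2 := hw (m.degree (b : MvPolynomial (Fin n) K)) ⟨⟨b, b.2, rfl⟩, e2 ▸ hdiv b μ hμ⟩
    exact Subtype.ext (h3 b.2 a.2 (w2.trans w1.symm))
  have h5 := congrArg (coeff (ν + m.degree (a : MvPolynomial (Fin n) K))) hf0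
  rw [coeff_zero, coeff_sum, Finset.sum_eq_single a, smul_eq_mul, coeff_mul,
    Finset.sum_eq_single (ν, m.degree (a : MvPolynomial (Fin n) K))] at h5
  · have := m.leadingCoeff_ne_zero_iff.mpr (h2 a a.2)
    exact mul_ne_zero ha this h5
  · intro q hq hne'
    by_contra hcon
    have hq' := Finset.HasAntidiagonal.mem_antidiagonal.mp hq
    obtain ⟨e1, e2⟩ := hbound a q.1 q.2 (left_ne_zero_of_mul hcon) (right_ne_zero_of_mul hcon) hq'
    exact hne' (Prod.ext (add_right_cancel e2) e1)
  · intro hcon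
    refine absurd ?_ hcon
    rw [Finset.HasAntidiagonal.mem_antidiagonal]
  · intro b _ hb
    rw [smul_eq_mul, coeff_mul]
    refine Finset.sum_eq_zero fun q hq => ?_
    by_contra hcon
    exact hb (hab b q.1 q.2 (left_ne_zero_of_mul hcon) (right_ne_zero_of_mul hcon)
      (Finset.HasAntidiagonal.mem_antidiagonal.mp hq))
  · simp

/-- the weight used to break ties -/
noncomputable def wt (μ : Fin n →₀ ℕ) : ℕ :=
  ∑ i ∈ Finset.univ.filter (fun i : Fin n => cls μ < i), μ i

theorem tie {t s ν : Fin n →₀ ℕ} {k : Fin n} (ht : t ≠ 0) (hs : s ≠ 0) (hk : cls t < k)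
    (hν : ∀ j ∈ ν.support, (j : ℕ) ≤ cls s) (e : ν + s = Finsupp.single k 1 + t) :
    cls t < cls s ∨ cls s = cls t ∧ wt t < wt s := by
  classical
  have hval : ∀ j, ν j + s j = (if k = j then 1 else 0) + t j := by
    intro j
    have := DFunLike.congr_fun e j
    simpa [Finsupp.single_apply] using this
  rcases lt_trichotomy (cls t) (cls s) with h | h | h
  · exact Or.inl h
  · right
    refine ⟨h.symm, ?_⟩
    unfold wt
    rw [← h]
    have hz : ∀ j : Fin n, cls t < j → ν j = 0 := by
      intro j hj
      by_contra h0
      have := hν j (Finsupp.mem_support_iff.mpr h0)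
      omega
    refine Finset.sum_lt_sum ?_ ⟨k, by simpa using hk, ?_⟩
    · intro j hj
      have h1 := hz j (by simpa using hj)
      have := hval j
      omega
    · have h1 := hz k hk
      have := hval k
      simp at this
      omega
  · exfalso
    obtain ⟨hi, hsi⟩ := cls_spec hs
    have h1 := hval ⟨cls s, hi⟩
    have hki : k ≠ ⟨cls s, hi⟩ := by
      rintro rfl
      simp at hk
      omega
    rw [if_neg hki, zero_add] at h1
    have := cls_le (μ := t) ⟨cls s, hi⟩ (by omega)
    simp at this
    omega

/-- order on terms over the generators -/
def lt0 (s t : H × (Fin n →₀ ℕ)) : Prop :=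
  Prod.Lex (fun x y : m.syn => x < y)
    (fun a b : H => cls (m.degree (b : MvPolynomial (Fin n) K)) < cls (m.degree (a : MvPolynomial (Fin n) K)) ∨
      cls (m.degree (a : MvPolynomial (Fin n) K)) = cls (m.degree (b : MvPolynomial (Fin n) K)) ∧
      wt (m.degree (b : MvPolynomial (Fin n) K)) < wt (m.degree (a : MvPolynomial (Fin n) K)))
    (m.toSyn (s.2 + m.degree (s.1 : MvPolynomial (Fin n) K)), s.1)
    (m.toSyn (t.2 + m.degree (t.1 : MvPolynomial (Fin n) K)), t.1)

noncomputable def stage0 (hIT : I ≠ ⊤) (hPB : IsPB m H I) : Stage n K where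
  A := H
  fin := inferInstance
  dec := by classical infer_instance
  c := fun h => ⟨cls (m.degree (h : MvPolynomial (Fin n) K)),
    (cls_spec (degree_ne_zero m I H hIT hPB.1 hPB.2.1 h h.2)).1⟩
  lt := lt0 m H
  S := LinearMap.ker (Fintype.linearCombination (MvPolynomial (Fin n) K)
    (fun h : H => (h : MvPolynomial (Fin n) K)))
  wf := by
    refine InvImage.wf (fun s : H × (Fin n →₀ ℕ) =>
      (m.toSyn (s.2 + m.degree (s.1 : MvPolynomial (Fin n) K)), s.1)) ?_
    refine WellFounded.prod_lex wellFounded_lt ?_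
    refine @Finite.wellFounded_of_trans_of_irrefl _ _ _ ⟨?_⟩ ⟨?_⟩
    · intro a b c h1 h2
      omega
    · intro a h
      omega
  trans := by
    intro x y z h1 h2
    simp only [lt0, Prod.lex_def] at *
    rcases h1 with h1 | ⟨h1, h1'⟩ <;> rcases h2 with h2 | ⟨h2, h2'⟩
    · exact Or.inl (h1.trans h2)
    · exact Or.inl (h2 ▸ h1)
    · exact Or.inl (h1 ▸ h2)
    · exact Or.inr ⟨h1.trans h2, by omega⟩
  transl := by
    intro a b μ ν ρ h
    simp only [lt0, Prod.lex_def] at *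
    rw [add_right_comm μ, add_right_comm ν, map_add _ _ ρ, map_add _ _ ρ]
    rcases h with h | ⟨h, h'⟩
    · left
      gcongr
    · right
      exact ⟨by rw [h], h'⟩
  indep := by
    intro f hf hM
    rw [LinearMap.mem_ker, Fintype.linearCombination_apply] at hf
    exact indep0 m I H hPB f hf hM
  red := by
    classical
    intro a k hk
    have ha0 := hPB.2.1 a a.2
    have hdeg : m.degree (X k * (a : MvPolynomial (Fin n) K)) =
        Finsupp.single k 1 + m.degree (a : MvPolynomial (Fin n) K) := by
      rw [m.degree_mul (X_ne_zero k) ha0, m.degree_X]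
    obtain ⟨p, hp, hp'⟩ := decomp0 m I H hPB (X k * (a : MvPolynomial (Fin n) K))
      (I.mul_mem_left _ (hPB.1 a a.2))
    refine ⟨p, ?_, ?_⟩
    · intro b ν hb
      obtain ⟨q1, q2⟩ := hp' b ν hb
      refine ⟨q1, ?_⟩
      simp only [lt0, Prod.lex_def]
      rw [hdeg] at q2
      rcases q2.lt_or_eq with q2 | q2
      · exact Or.inl q2
      · right
        refine ⟨q2, ?_⟩
        exact tie (degree_ne_zero m I H hIT hPB.1 hPB.2.1 a a.2)
          (degree_ne_zero m I H hIT hPB.1 hPB.2.1 b b.2) hk q1 (m.toSyn.injective q2)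
    · rw [LinearMap.mem_ker, map_sub, Fintype.linearCombination_apply _ _ p, hp, sub_eq_zero]
      exact Fintype.linearCombination_apply_single _ _ _ _

end

end Pomm

/-- Thm. 2.5: a Pommaret basis induces a finite free resolution
`0 → P^{r_{n-d}} → ⋯ → P^{r_0} → I → 0` with
`r_i = ∑_{k=d}^{n-i} C(n-k, i) β₀^{(k)}`.  (Classes are 0-based here, so the paper's
class `k` is `c = k - 1`, and `r i = ∑_{c=d₀}^{n-1} C(n-1-c, i) β₀^{(c)}`; the binomial
coefficient vanishes automatically for `c > n-1-i`, and `r i = 0` for `i > n - d`.) -/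
theorem statement4 {n : ℕ} {K : Type*} [Field K] (m : MonomialOrder (Fin n))
    (I : Ideal (MvPolynomial (Fin n) K)) (hI0 : I ≠ ⊥) (hIT : I ≠ ⊤) (hIhom : IsHomIdeal I)
    (H : Finset (MvPolynomial (Fin n) K)) (hPB : IsPB m H I)
    (d0 : ℕ) (hd0 : IsLeast {c : ℕ | ∃ h ∈ H, cls (ldeg m h) = c} d0)
    (r : ℕ → ℕ)
    (hr : ∀ i, r i = ∑ c ∈ Finset.Icc d0 (n - 1), Nat.choose (n - 1 - c) i *
        Set.ncard {h : MvPolynomial (Fin n) K | h ∈ H ∧ cls (ldeg m h) = c}) :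
    ∃ (g : ∀ i : ℕ, ((Fin (r (i + 1)) → MvPolynomial (Fin n) K) →ₗ[MvPolynomial (Fin n) K]
          (Fin (r i) → MvPolynomial (Fin n) K)))
      (ε : (Fin (r 0) → MvPolynomial (Fin n) K) →ₗ[MvPolynomial (Fin n) K]
          MvPolynomial (Fin n) K),
      LinearMap.range ε = (I : Submodule (MvPolynomial (Fin n) K) (MvPolynomial (Fin n) K)) ∧
      Function.Exact (g 0) ε ∧
      ∀ i : ℕ, Function.Exact (g (i + 1)) (g i) := by
  classical
  obtain ⟨h1, h2, -⟩ := id hPB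
  have hlt : ∀ h ∈ H, cls (ldeg m h) < n := fun h hh =>
    (Pomm.cls_spec (Pomm.degree_ne_zero m I H hIT h1 h2 h hh)).1
  let Y := Pomm.stage0 m I H hIT hPB
  let φ : (H → MvPolynomial (Fin n) K) →ₗ[MvPolynomial (Fin n) K] MvPolynomial (Fin n) K :=
    Fintype.linearCombination (MvPolynomial (Fin n) K) (fun h : H => (h : MvPolynomial (Fin n) K))
  have hφ : LinearMap.range φ = I := by
    apply le_antisymm
    · rintro _ ⟨f, rfl⟩
      rw [Fintype.linearCombination_apply]
      exact Submodule.sum_mem _ fun h _ => I.mul_mem_left _ (h1 h h.2)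
    · intro f hf
      obtain ⟨p, hp, -⟩ := Pomm.decomp0 m I H hPB f hf
      exact ⟨p, by rw [Fintype.linearCombination_apply]; exact hp⟩
  have hex : Function.Exact (Y.dd 0) φ := by
    intro x
    have h : x ∈ LinearMap.range Y.d ↔ x ∈ Y.S := by
      rw [Pomm.Stage.range_d]
    exact h.symm
  have hr' : ∀ i, r i = ∑ a : Y.A, Nat.choose (n - 1 - (Y.c a : ℕ)) i := by
    intro i
    have e1 : ∑ a : Y.A, Nat.choose (n - 1 - (Y.c a : ℕ)) i =
        ∑ h : H, Nat.choose (n - 1 - cls (ldeg m (h : MvPolynomial (Fin n) K))) i :=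
      Fintype.sum_equiv (Equiv.refl _) _ _ fun _ => rfl
    rw [e1, hr, Finset.sum_coe_sort H (fun h => Nat.choose (n - 1 - cls (ldeg m h)) i),
      ← Finset.sum_fiberwise_of_maps_to (s := H) (t := Finset.Icc d0 (n - 1))
        (g := fun h => cls (ldeg m h))]
    · refine Finset.sum_congr rfl fun c _ => ?_
      have e2 : {h : MvPolynomial (Fin n) K | h ∈ H ∧ cls (ldeg m h) = c} =
          ↑(H.filter fun h => cls (ldeg m h) = c) := by
        ext h
        simp
      rw [e2, Set.ncard_coe_finset, Finset.sum_congr rfl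
        (g := fun _ => Nat.choose (n - 1 - c) i), Finset.sum_const, smul_eq_mul, mul_comm]
      intro h hh
      rw [(Finset.mem_filter.mp hh).2]
    · intro h hh
      rw [Finset.mem_Icc]
      have := hlt h hh
      exact ⟨hd0.2 ⟨h, hh, rfl⟩, by omega⟩
  obtain ⟨g, ε, q1, q2, q3⟩ := Y.resolution φ hex r hr'
  exact ⟨g, ε, q1.trans hφ, q2, q3⟩
end
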